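/- arXiv:1102.1078 — 3 statements merged into one kernel-verified Lean document; each statement's English description precedes it below -/
import Mathlib

section
/- Let a ∈ (0,1/2]. (1) If K ≥ 1, then for all r, s ∈ (0,1) with r ≠ s and |r - s| ∈ (0,1): |φ_K^a(r) - φ_K^a(s)| ≤ φ_K^a(|r - s|). (2) If 0 < K ≤ 1, the inequality is reversed: |φ_K^a(r) - φ_K^a(s)| ≥ φ_K^a(|r - s|). -/
open Real Set

/-- Shifted factorial (Pochhammer/Appell symbol) `(a)ₙ`. -/
noncomputable def shiftedFact (a : ℝ) : ℕ → ℝ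
  | 0 => 1
  | n + 1 => shiftedFact a n * (a + n)

/-- Gaussian hypergeometric function `F(a,b;c;x)` as a series. -/
noncomputable def hypF (a b c x : ℝ) : ℝ :=
  ∑' n : ℕ, shiftedFact a n * shiftedFact b n / (shiftedFact c n * (Nat.factorial n : ℝ)) * x ^ n

/-- Generalized complete elliptic integral of the first kind `𝒦ₐ(r)`. -/
noncomputable def ellK (a r : ℝ) : ℝ := (Real.pi / 2) * hypF a (1 - a) 1 (r ^ 2)

/-- Generalized complete elliptic integral of the second kind `ℰₐ(r)`. -/
noncomputable def ellE (a r : ℝ) : ℝ := (Real.pi / 2) * hypF (a - 1) (1 - a) 1 (r ^ 2)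

/-- The generalized Grötzsch modulus `μₐ(r)`. -/
noncomputable def muFn (a r : ℝ) : ℝ :=
  Real.pi / (2 * Real.sin (Real.pi * a)) * ellK a (Real.sqrt (1 - r ^ 2)) / ellK a r

/-- Inverse of `μₐ` (on `(0,1)`, where it is a decreasing homeomorphism onto `(0,∞)`). -/
noncomputable def muInv (a : ℝ) : ℝ → ℝ := Function.invFunOn (muFn a) (Set.Ioo 0 1)

/-- The generalized modular function `φ_K^a(r)`. -/
noncomputable def phiK (a K r : ℝ) : ℝ := muInv a (muFn a r / K)

/-- `η_K^a(x) = (s/s')²` where `s = φ_K^a(√(x/(1+x)))`. -/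
noncomputable def etaK (a K x : ℝ) : ℝ :=
  ((phiK a K (Real.sqrt (x / (1 + x)))) / Real.sqrt (1 - (phiK a K (Real.sqrt (x / (1 + x)))) ^ 2)) ^ 2

/-- `λₐ(K)`. -/
noncomputable def lambdaA (a K : ℝ) : ℝ :=
  (phiK a K (1 / Real.sqrt 2) / phiK a (1 / K) (1 / Real.sqrt 2)) ^ 2

/-- The generalized inverse hyperbolic tangent `artanh_p`. -/
noncomputable def artanhp (p x : ℝ) : ℝ := ∫ t in (0:ℝ)..x, (1 - t ^ p)⁻¹

/-- The inverse hyperbolic tangent. -/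
noncomputable def artanh (x : ℝ) : ℝ := (1 / 2) * Real.log ((1 + x) / (1 - x))

/-- Euler beta function. -/
noncomputable def betaB (x y : ℝ) : ℝ := Real.Gamma x * Real.Gamma y / Real.Gamma (x + y)

/-- `μ_{a,c}(r)`, the two-parameter generalized modulus. -/
noncomputable def muAC (a c r : ℝ) : ℝ :=
  betaB a (c - a) * hypF a (c - a) c (1 - r ^ 2) / (2 * hypF a (c - a) c (r ^ 2))

/-- Inverse of `μ_{a,c}` on `(0,1)`. -/
noncomputable def muACInv (a c : ℝ) : ℝ → ℝ := Function.invFunOn (muAC a c) (Set.Ioo 0 1)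

/-- The modular function `φ_K^{a,c}(r)`. -/
noncomputable def phiAC (a c K r : ℝ) : ℝ := muACInv a c (muAC a c r / K)


noncomputable def cc (a : ℝ) (n : ℕ) : ℝ :=
  shiftedFact a n * shiftedFact (1 - a) n / (shiftedFact 1 n * (Nat.factorial n : ℝ))

noncomputable def GG (a x : ℝ) : ℝ := ∑' n : ℕ, cc a n * x ^ n

noncomputable def SS (a x : ℝ) : ℝ := ∑' n : ℕ, cc a n / (n + 1) * x ^ n

lemma sf_one_pos (n : ℕ) : 0 < shiftedFact 1 n := by
  induction n with
  | zero => simp [shiftedFact]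
  | succ k ih => simp only [shiftedFact]; positivity

lemma cc_zero (a : ℝ) : cc a 0 = 1 := by simp [cc, shiftedFact]

lemma cc_succ (a : ℝ) (n : ℕ) :
    cc a (n + 1) * ((n : ℝ) + 1) ^ 2 = cc a n * ((a + n) * (1 - a + n)) := by
  have h1 := (sf_one_pos n).ne'
  have h2 : (Nat.factorial n : ℝ) ≠ 0 := by positivity
  have h3 : (n : ℝ) + 1 ≠ 0 := by positivity
  have h4 : (1 : ℝ) + n ≠ 0 := by positivity
  simp only [cc, shiftedFact, Nat.factorial_succ]
  push_cast
  field_simp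
  ring

section
variable {a : ℝ} (h0 : 0 < a) (h1 : a ≤ 1 / 2)
include h0 h1

lemma cc_pos (n : ℕ) : 0 < cc a n := by
  induction n with
  | zero => simp [cc_zero]
  | succ k ih =>
    have h := cc_succ a k
    have h2 : 0 < 1 - a + k := by have : (0:ℝ) ≤ k := by positivity
                                  linarith
    have : 0 < cc a k * ((a + k) * (1 - a + k)) := by positivity
    rw [← h] at this
    exact pos_of_mul_pos_left this (by positivity)

lemma cc_le_one (n : ℕ) : cc a n ≤ 1 := by
  induction n with
  | zero => simp [cc_zero]
  | succ k ih =>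
    have h := cc_succ a k
    have hk : (0:ℝ) ≤ k := by positivity
    have hp := cc_pos h0 h1 k
    have h2 : (a + k) * (1 - a + k) ≤ ((k:ℝ) + 1) ^ 2 := by nlinarith
    have : cc a (k+1) * ((k:ℝ) + 1) ^ 2 ≤ 1 * ((k:ℝ) + 1) ^ 2 := by
      rw [h]
      exact mul_le_mul ih h2 (mul_nonneg (by positivity) (by linarith)) (by norm_num)
    exact le_of_mul_le_mul_right this (by positivity)

lemma cc_lower (n : ℕ) : a * (1 - a) ≤ cc a (n + 1) * ((n:ℝ) + 1) := by
  induction n with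
  | zero => have := cc_succ a 0; simp [cc_zero] at this; simp [this]
  | succ k ih =>
    refine ih.trans ?_
    have h := cc_succ a (k+1)
    have hp := cc_pos h0 h1 (k+1)
    have hab : 0 < a * (1 - a) := mul_pos h0 (by linarith)
    push_cast at h ⊢
    have hk : (0:ℝ) < (k:ℝ) + 1 + 1 := by positivity
    refine le_of_mul_le_mul_right ?_ hk
    have : cc a (k + 1 + 1) * ((k:ℝ) + 1 + 1) * ((k:ℝ) + 1 + 1) = cc a (k + 1) * ((a + (k + 1)) * (1 - a + (k + 1))) := by
      rw [← h]; ring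
    rw [this]
    have : cc a (k + 1) * ((a + (k + 1)) * (1 - a + (k + 1))) - cc a (k + 1) * ((k:ℝ) + 1) * ((k:ℝ) + 1 + 1) = cc a (k+1) * (a * (1-a)) := by ring
    nlinarith [mul_pos hp hab]

lemma cc_not_summable : ¬ Summable (cc a) := by
  intro h
  have h' := (summable_nat_add_iff 1).2 h
  have hab : 0 < a * (1 - a) := mul_pos h0 (by linarith)
  have : Summable (fun n : ℕ => (a * (1 - a)) * (1 / ((n + 1 : ℕ) : ℝ))) := by
    refine Summable.of_nonneg_of_le (fun n => by positivity) (fun n => ?_) h'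
    have := cc_lower h0 h1 n
    push_cast
    rw [mul_one_div, div_le_iff₀ (by positivity)]
    exact this
  rw [summable_mul_left_iff hab.ne'] at this
  exact Real.not_summable_one_div_natCast ((summable_nat_add_iff 1).1 this)

end

lemma summable_bdd {d : ℕ → ℝ} (hd : ∀ n, |d n| ≤ 1) {x : ℝ} (hx : |x| < 1) :
    Summable (fun n => d n * x ^ n) := by
  refine Summable.of_norm_bounded (summable_geometric_of_lt_one (abs_nonneg x) hx) (fun n => ?_)
  rw [norm_mul, norm_pow, Real.norm_eq_abs, Real.norm_eq_abs]
  exact mul_le_of_le_one_left (by positivity) (hd n)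

lemma summable_nd {d : ℕ → ℝ} (hd : ∀ n, |d n| ≤ 1) {x : ℝ} (hx : |x| < 1) :
    Summable (fun n : ℕ => (n:ℝ) * d n * x ^ n) := by
  have := summable_pow_mul_geometric_of_norm_lt_one (R := ℝ) 1 (r := |x|) (by simpa using hx)
  refine Summable.of_norm_bounded this (fun n => ?_)
  rw [norm_mul, norm_mul, norm_pow, Real.norm_eq_abs, Real.norm_eq_abs, Real.norm_eq_abs, pow_one,
    abs_of_nonneg (by positivity : (0:ℝ) ≤ n)]
  have : (n:ℝ) * |d n| ≤ n := mul_le_of_le_one_right (by positivity) (hd n)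
  gcongr

lemma summable_nd' {d : ℕ → ℝ} (hd : ∀ n, |d n| ≤ 1) {x : ℝ} (hx : |x| < 1) :
    Summable (fun n : ℕ => ((n:ℝ) + 1) * d (n+1) * x ^ n) := by
  have h1 := summable_nd (d := fun n => d (n+1)) (fun n => hd _) hx
  have h2 := summable_bdd (d := fun n => d (n+1)) (fun n => hd _) hx
  refine (h1.add h2).congr (fun n => ?_)
  ring

lemma hasDeriv_series {d : ℕ → ℝ} (hd : ∀ n, |d n| ≤ 1) {x : ℝ} (hx : |x| < 1) :
    HasDerivAt (fun y => ∑' n : ℕ, d n * y ^ n) (∑' n : ℕ, ((n:ℝ) + 1) * d (n+1) * x ^ n) x := by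
  obtain ⟨ρ, hρ1, hρ2⟩ := exists_between hx
  have hρ0 : 0 < ρ := (abs_nonneg x).trans_lt hρ1
  have hρa : |ρ| < 1 := by rwa [abs_of_pos hρ0]
  have hu : Summable (fun n : ℕ => (n:ℝ) * ρ ^ (n-1)) := by
    rw [← summable_nat_add_iff 1]
    have := summable_nd' (d := fun _ => 1) (by simp) hρa
    refine this.congr (fun n => ?_)
    simp
  have key := hasDerivAt_tsum_of_isPreconnected (𝕜 := ℝ) (t := Metric.ball (0:ℝ) ρ)
    (g := fun n y => d n * y ^ n) (g' := fun n y => d n * (n * y ^ (n-1))) (y₀ := 0) (y := x) hu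
    Metric.isOpen_ball (convex_ball _ _).isPreconnected
    (fun n y _ => (hasDerivAt_pow n y).const_mul (d n))
    (fun n y hy => by
      have hy' : |y| < ρ := by simpa using hy
      rw [norm_mul, norm_mul, norm_pow, Real.norm_eq_abs, Real.norm_eq_abs, Real.norm_eq_abs,
        abs_of_nonneg (by positivity : (0:ℝ) ≤ n)]
      calc |d n| * (n * |y| ^ (n-1)) ≤ 1 * (n * ρ ^ (n-1)) := by
            gcongr
            exact hd n
        _ = _ := one_mul _)
    (by simpa using hρ0) (summable_bdd hd (by simp)) (by simpa using hρ1)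
  refine key.congr_deriv ?_
  have hs : Summable (fun n : ℕ => d n * ((n:ℝ) * x ^ (n-1))) := by
    rw [← summable_nat_add_iff 1]
    refine (summable_nd' hd hx).congr (fun n => ?_)
    simp; ring
  rw [hs.tsum_eq_zero_add]
  simp
  congr 1; ext n; ring

noncomputable def GD (a x : ℝ) : ℝ := ∑' n : ℕ, ((n:ℝ) + 1) * cc a (n+1) * x ^ n

section
variable {a : ℝ} (h0 : 0 < a) (h1 : a ≤ 1 / 2)
include h0 h1

lemma cc_abs (n : ℕ) : |cc a n| ≤ 1 := by
  rw [abs_of_pos (cc_pos h0 h1 n)]; exact cc_le_one h0 h1 n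

lemma ccS_abs (n : ℕ) : |cc a n / (n + 1)| ≤ 1 := by
  rw [abs_of_pos (div_pos (cc_pos h0 h1 n) (by positivity)), div_le_one (by positivity)]
  have := cc_le_one h0 h1 n
  have hk : (0:ℝ) ≤ n := by positivity
  linarith

lemma GG_deriv {x : ℝ} (hx : |x| < 1) : HasDerivAt (GG a) (GD a x) x :=
  hasDeriv_series (cc_abs h0 h1) hx

lemma SS_deriv {x : ℝ} (hx : |x| < 1) : HasDerivAt (fun y => y * SS a y) (GG a x) x := by
  have hd : ∀ n : ℕ, |(fun n : ℕ => cc a (n-1) / n) n| ≤ 1 := by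
    intro n
    cases n with
    | zero => simp
    | succ k => simpa using ccS_abs h0 h1 k
  have := (hasDeriv_series hd hx)
  have e : (∑' n : ℕ, ((n:ℝ) + 1) * (fun n : ℕ => cc a (n-1) / n) (n+1) * x ^ n) = GG a x := by
    unfold GG
    congr 1; ext n
    have : (n:ℝ) + 1 ≠ 0 := by positivity
    simp only [Nat.add_sub_cancel]; push_cast; field_simp
  rw [e] at this
  refine this.congr_of_eventuallyEq ?_
  have : ∀ᶠ y : ℝ in nhds x, |y| < 1 := (continuous_abs.tendsto x).eventually_lt_const hx
  filter_upwards [this] with y hy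
  rw [(summable_bdd hd hy).tsum_eq_zero_add]
  simp [SS]
  rw [← tsum_mul_left]
  congr 1; ext n; ring

lemma GD_eq {x : ℝ} (hx : |x| < 1) : (1 - x) * GD a x = a * (1 - a) * SS a x := by
  have s1 := summable_nd' (cc_abs h0 h1) hx
  have s2 := summable_nd (cc_abs h0 h1) hx
  have e : x * GD a x = ∑' n : ℕ, (n:ℝ) * cc a n * x ^ n := by
    rw [s2.tsum_eq_zero_add]
    simp [GD]
    rw [← tsum_mul_left]
    congr 1; ext n; ring
  rw [sub_mul, one_mul, e, GD, ← s1.tsum_sub s2, SS, ← tsum_mul_left]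
  congr 1; ext n
  have h := cc_succ a n
  have : (n:ℝ) + 1 ≠ 0 := by positivity
  have h2 : cc a (n+1) * (n+1) = cc a n * ((a + n) * (1 - a + n)) / (n+1) := by
    field_simp; linarith
  have : ((n:ℝ)+1) * cc a (n+1) - n * cc a n = a * (1-a) * (cc a n / (n+1)) := by
    rw [mul_comm, h2]; field_simp; ring
  rw [← sub_mul, this]; ring

lemma GG_ge_one {x : ℝ} (hx : 0 ≤ x) (hx' : x < 1) : 1 ≤ GG a x := by
  have s := summable_bdd (cc_abs h0 h1) (x := x) (by rwa [abs_of_nonneg hx])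
  have := s.le_tsum 0 (fun n _ => mul_nonneg (cc_pos h0 h1 n).le (by positivity))
  simpa [cc_zero, GG] using this

lemma SS_pos {x : ℝ} (hx : 0 ≤ x) (hx' : x < 1) : 0 < SS a x := by
  have s := summable_bdd (ccS_abs h0 h1) (x := x) (by rwa [abs_of_nonneg hx])
  have := s.le_tsum 0 (fun n _ => mul_nonneg (div_pos (cc_pos h0 h1 n) (by positivity)).le (by positivity))
  have : 1 ≤ SS a x := by simpa [cc_zero, SS] using this
  linarith

lemma SS_le {x : ℝ} (hx : 0 ≤ x) (hx' : x < 1) : SS a x ≤ GG a x := by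
  have hxa : |x| < 1 := by rwa [abs_of_nonneg hx]
  refine (summable_bdd (ccS_abs h0 h1) hxa).tsum_le_tsum (fun n => ?_) (summable_bdd (cc_abs h0 h1) hxa)
  gcongr
  exact div_le_self (cc_pos h0 h1 n).le (by have : (0:ℝ) ≤ n := by positivity
                                            linarith)

lemma GD_pos {x : ℝ} (hx : 0 ≤ x) (hx' : x < 1) : 0 < GD a x := by
  have h := GD_eq h0 h1 (x := x) (by rwa [abs_of_nonneg hx])
  have := SS_pos h0 h1 hx hx'
  have hab : 0 < a * (1 - a) := mul_pos h0 (by linarith)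
  have h3 : 0 < (1 - x) * GD a x := by rw [h]; positivity
  exact pos_of_mul_pos_right h3 (by linarith)

lemma GG_mono {x y : ℝ} (hx : 0 ≤ x) (hxy : x ≤ y) (hy : y < 1) : GG a x ≤ GG a y := by
  refine (summable_bdd (cc_abs h0 h1) ?_).tsum_le_tsum (fun n => ?_) (summable_bdd (cc_abs h0 h1) ?_)
  · rw [abs_of_nonneg hx]; linarith
  · have := (cc_pos h0 h1 n).le
    gcongr
  · rwa [abs_of_nonneg (hx.trans hxy)]

lemma GG_unbdd (B : ℝ) : ∃ x, 1/2 < x ∧ x < 1 ∧ B < GG a x := by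
  have ht := (not_summable_iff_tendsto_nat_atTop_of_nonneg (fun n => (cc_pos h0 h1 n).le)).1
    (cc_not_summable h0 h1)
  obtain ⟨N, hN⟩ := (ht.eventually_gt_atTop B).exists
  have hc : Continuous (fun x : ℝ => ∑ n ∈ Finset.range N, cc a n * x ^ n) := by fun_prop
  have h2 : ∀ᶠ x : ℝ in nhds 1, B < ∑ n ∈ Finset.range N, cc a n * x ^ n := by
    refine (hc.tendsto 1).eventually_const_lt ?_
    simpa using hN
  have h3 : ∀ᶠ x : ℝ in nhdsWithin 1 (Iio 1), 1/2 < x :=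
    nhdsWithin_le_nhds (eventually_gt_nhds (by norm_num))
  obtain ⟨x, ⟨hx1, hx2⟩, hx3⟩ := (((h2.filter_mono nhdsWithin_le_nhds).and h3).and self_mem_nhdsWithin).exists
  refine ⟨x, hx2, hx3, hx1.trans_le ?_⟩
  have hx0 : 0 ≤ x := by linarith
  exact (summable_bdd (cc_abs h0 h1) (x := x) (by rwa [abs_of_nonneg hx0])).sum_le_tsum _
    (fun n _ => mul_nonneg (cc_pos h0 h1 n).le (by positivity))

end

noncomputable def ff (a u : ℝ) : ℝ := GG a (1 - u) / GG a u

noncomputable def QQ (a x : ℝ) : ℝ :=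
  (1 - x) * SS a (1 - x) * GG a x + GG a (1 - x) * (x * SS a x)

section
variable {a : ℝ} (h0 : 0 < a) (h1 : a ≤ 1 / 2)
include h0 h1

lemma QQ_deriv {x : ℝ} (hx : x ∈ Ioo (0:ℝ) 1) : HasDerivAt (QQ a) 0 x := by
  obtain ⟨hx0, hx1⟩ := hx
  have hxa : |x| < 1 := by rwa [abs_of_pos hx0]
  have hya : |1 - x| < 1 := by rw [abs_of_pos (by linarith)]; linarith
  have hsub : HasDerivAt (fun y : ℝ => 1 - y) (-1) x := by
    simpa using (hasDerivAt_id x).const_sub 1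
  have d1 := (SS_deriv h0 h1 hya).comp x hsub
  have d2 := GG_deriv h0 h1 hxa
  have d3 := (GG_deriv h0 h1 hya).comp x hsub
  have d4 := SS_deriv h0 h1 hxa
  have := (d1.mul d2).add (d3.mul d4)
  refine this.congr_deriv ?_
  simp only [Function.comp]
  have e1 := GD_eq h0 h1 hxa
  have e2 := GD_eq h0 h1 hya
  have hab : a * (1 - a) ≠ 0 := (mul_pos h0 (by linarith)).ne'
  refine mul_left_cancel₀ hab ?_
  linear_combination (-GD a x * (1-x)) * e2 + (x * GD a (1 - x)) * e1

lemma QQ_const {x y : ℝ} (hx : x ∈ Ioo (0:ℝ) 1) (hy : y ∈ Ioo (0:ℝ) 1) : QQ a x = QQ a y := by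
  refine isOpen_Ioo.is_const_of_deriv_eq_zero isPreconnected_Ioo
    (fun z hz => (QQ_deriv h0 h1 hz).differentiableAt.differentiableWithinAt)
    (fun z hz => (QQ_deriv h0 h1 hz).deriv) hx hy

lemma QQ_pos : 0 < QQ a (1/2) := by
  have := SS_pos h0 h1 (x := 1/2) (by norm_num) (by norm_num)
  have := GG_ge_one h0 h1 (x := 1/2) (by norm_num) (by norm_num)
  unfold QQ; norm_num at *; positivity

lemma ff_deriv {x : ℝ} (hx : x ∈ Ioo (0:ℝ) 1) :
    HasDerivAt (ff a) (-(a * (1 - a) * QQ a (1/2)) / (x * ((1 - x) * GG a x ^ 2))) x := by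
  rw [← QQ_const h0 h1 hx (y := 1/2) (by norm_num)]
  obtain ⟨hx0, hx1⟩ := hx
  have hxa : |x| < 1 := by rwa [abs_of_pos hx0]
  have hya : |1 - x| < 1 := by rw [abs_of_pos (by linarith)]; linarith
  have hsub : HasDerivAt (fun y : ℝ => 1 - y) (-1) x := by
    simpa using (hasDerivAt_id x).const_sub 1
  have d2 := GG_deriv h0 h1 hxa
  have d3 := (GG_deriv h0 h1 hya).comp x hsub
  have hG : GG a x ≠ 0 := by have := GG_ge_one h0 h1 hx0.le hx1; positivity
  refine (d3.div d2 hG).congr_deriv ?_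
  simp only [Function.comp]
  have e1 := GD_eq h0 h1 hxa
  have e2 := GD_eq h0 h1 hya
  have hx1' : 1 - x ≠ 0 := by linarith
  rw [div_eq_div_iff (by positivity) (by positivity), QQ]
  linear_combination (-GG a x^3 * (1-x)) * e2 - (x * GG a x ^2 * GG a (1 - x)) * e1

lemma ff_pos {x : ℝ} (hx : x ∈ Ioo (0:ℝ) 1) : 0 < ff a x := by
  have := GG_ge_one h0 h1 hx.1.le hx.2
  have := GG_ge_one h0 h1 (x := 1 - x) (by linarith [hx.2]) (by linarith [hx.1])
  unfold ff; positivity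

lemma ff_anti : StrictAntiOn (ff a) (Ioo 0 1) := by
  refine strictAntiOn_of_deriv_neg (convex_Ioo _ _)
    (fun x hx => (ff_deriv h0 h1 hx).continuousAt.continuousWithinAt) (fun x hx => ?_)
  rw [interior_Ioo] at hx
  rw [(ff_deriv h0 h1 hx).deriv]
  have := GG_ge_one h0 h1 hx.1.le hx.2
  have h2 := QQ_pos h0 h1
  have hab : 0 < a * (1 - a) := mul_pos h0 (by linarith)
  have := hx.1
  have : 0 < 1 - x := by linarith [hx.2]
  rw [neg_div]
  have : 0 < (a * (1 - a) * QQ a (1/2)) / (x * ((1 - x) * GG a x ^ 2)) := by positivity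
  linarith

lemma ff_surj {y : ℝ} (hy : 0 < y) : ∃ x ∈ Ioo (0:ℝ) 1, ff a x = y := by
  have big : ∀ y : ℝ, 0 < y → ∃ x ∈ Ioo (0:ℝ) 1, y ≤ ff a x := by
    intro y hy
    obtain ⟨x, hx1, hx2, hx3⟩ := GG_unbdd h0 h1 (y * GG a (1/2))
    refine ⟨1 - x, ⟨by linarith, by linarith⟩, ?_⟩
    have hg := GG_ge_one h0 h1 (x := 1 - x) (by linarith) (by linarith)
    have hm := GG_mono h0 h1 (x := 1 - x) (y := 1/2) (by linarith) (by linarith) (by norm_num)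
    rw [ff, le_div_iff₀ (by linarith), sub_sub_cancel]
    nlinarith
  obtain ⟨u, hu, hu'⟩ := big y hy
  obtain ⟨v, hv, hv'⟩ := big y⁻¹ (by positivity)
  have hv2 : 1 - v ∈ Ioo (0:ℝ) 1 := ⟨by linarith [hv.2], by linarith [hv.1]⟩
  have hv3 : ff a (1 - v) ≤ y := by
    have : ff a (1 - v) = (ff a v)⁻¹ := by unfold ff; rw [inv_div, sub_sub_cancel]
    rw [this]
    exact inv_le_of_inv_le₀ hy hv'
  have := isPreconnected_Ioo.intermediate_value hv2 hu (f := ff a)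
    (fun x hx => (ff_deriv h0 h1 hx).continuousAt.continuousWithinAt) ⟨hv3, hu'⟩
  exact this

lemma W_anti : AntitoneOn (fun x => (1 - x) * GG a x ^ 2) (Ioo 0 1) := by
  have hd : ∀ x ∈ Ioo (0:ℝ) 1, HasDerivAt (fun x => (1 - x) * GG a x ^ 2)
      (-1 * GG a x ^ 2 + (1 - x) * (2 * GG a x * GD a x)) x := by
    intro x hx
    have hxa : |x| < 1 := by rw [abs_of_pos hx.1]; exact hx.2
    have hsub : HasDerivAt (fun y : ℝ => 1 - y) (-1) x := by
      simpa using (hasDerivAt_id x).const_sub 1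
    refine (hsub.mul ((GG_deriv h0 h1 hxa).pow 2)).congr_deriv ?_
    simp
  refine antitoneOn_of_deriv_nonpos (convex_Ioo _ _)
    (fun x hx => (hd x hx).continuousAt.continuousWithinAt)
    (fun x hx => ?_) (fun x hx => ?_)
  · rw [interior_Ioo] at hx
    exact (hd x hx).differentiableAt.differentiableWithinAt
  · rw [interior_Ioo] at hx
    rw [(hd x hx).deriv]
    have hxa : |x| < 1 := by rw [abs_of_pos hx.1]; exact hx.2
    have e := GD_eq h0 h1 hxa
    have h3 := GG_ge_one h0 h1 hx.1.le hx.2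
    have h4 := SS_le h0 h1 hx.1.le hx.2
    have h5 := SS_pos h0 h1 hx.1.le hx.2
    have h6 : a * (1 - a) ≤ 1/2 := by nlinarith
    have h7 : (1 - x) * GD a x ≤ 1/2 * GG a x := by
      rw [e]; exact mul_le_mul h6 h4 h5.le (by norm_num)
    nlinarith

lemma diff_mono {ρ : ℝ} (hρ : 1 < ρ) : MonotoneOn (fun x => ff a x - ff a (ρ * x)) (Ioo 0 (1/ρ)) := by
  have hρ0 : 0 < ρ := by linarith
  have hm : ∀ x ∈ Ioo (0:ℝ) (1/ρ), x ∈ Ioo (0:ℝ) 1 ∧ ρ * x ∈ Ioo (0:ℝ) 1 := by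
    intro x hx
    have h3 : x * ρ < 1 := (lt_div_iff₀ hρ0).1 hx.2
    have := hx.1
    refine ⟨⟨this, by nlinarith⟩, by positivity, by linarith⟩
  have hd : ∀ x ∈ Ioo (0:ℝ) (1/ρ), HasDerivAt (fun x => ff a x - ff a (ρ * x)) _ x := fun x hx =>
    (ff_deriv h0 h1 (hm x hx).1).sub ((ff_deriv h0 h1 (hm x hx).2).comp x
      ((hasDerivAt_id x).const_mul ρ))
  refine monotoneOn_of_deriv_nonneg (convex_Ioo _ _)
    (fun x hx => (hd x hx).continuousAt.continuousWithinAt)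
    (fun x hx => ?_) (fun x hx => ?_)
  · rw [interior_Ioo] at hx
    exact (hd x hx).differentiableAt.differentiableWithinAt
  · rw [interior_Ioo] at hx
    rw [(hd x hx).deriv]
    obtain ⟨m1, m2⟩ := hm x hx
    have hw := W_anti h0 h1 m1 m2 (by nlinarith [hx.1])
    have g2 := GG_ge_one h0 h1 m2.1.le m2.2
    have hx0 := hx.1
    have l2 : 0 < 1 - ρ * x := by linarith [m2.2]
    have w2 : 0 < (1 - ρ * x) * GG a (ρ * x) ^ 2 := by positivity
    have hC : 0 < a * (1 - a) * QQ a (1/2) :=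
      mul_pos (mul_pos h0 (by linarith)) (QQ_pos h0 h1)
    simp only at hw
    generalize (1 - ρ * x) * GG a (ρ * x) ^ 2 = w at *
    generalize (1 - x) * GG a x ^ 2 = v at *
    generalize a * (1 - a) * QQ a (1/2) = C at *
    have hv : 0 < v := by linarith
    have : -C / (x * v) - -C / (ρ * x * w) * (ρ * 1) = C / x * (1 / w - 1 / v) := by
      field_simp; ring
    rw [this]
    have : 1 / v ≤ 1 / w := one_div_le_one_div_of_le w2 hw
    exact mul_nonneg (by positivity) (by linarith)

lemma core {L u1 u2 v1 v2 : ℝ} (hL : 1 ≤ L) (hu1 : u1 ∈ Ioo (0:ℝ) 1) (hu2 : u2 ∈ Ioo (0:ℝ) 1)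
    (hv1 : v1 ∈ Ioo (0:ℝ) 1) (hv2 : v2 ∈ Ioo (0:ℝ) 1) (hlt : u1 < u2)
    (e1 : ff a u1 = L * ff a v1) (e2 : ff a u2 = L * ff a v2) : v2 * u1 ≤ v1 * u2 := by
  by_contra! hcon
  have hu10 := hu1.1
  have hv10 := hv1.1
  set ρ := u2 / u1 with hρ
  have hρ1 : 1 < ρ := (one_lt_div hu10).2 hlt
  have hρ0 : 0 < ρ := by linarith
  have eu : ρ * u1 = u2 := by rw [hρ]; field_simp
  have hvv : ρ * v1 < v2 := by rw [hρ, div_mul_eq_mul_div, div_lt_iff₀ hu10]; linarith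
  have p1 := ff_pos h0 h1 hv1
  have huv : u1 ≤ v1 := by
    by_contra! h
    have := ff_anti h0 h1 hv1 hu1 h
    nlinarith
  have hρv : ρ * v1 ∈ Ioo (0:ℝ) 1 := ⟨by positivity, hvv.trans hv2.2⟩
  have m := (diff_mono h0 h1 hρ1)
    ⟨hu10, by rw [lt_div_iff₀ hρ0]; linarith [hu2.2]⟩
    ⟨hv10, by rw [lt_div_iff₀ hρ0]; linarith [hρv.2]⟩ huv
  simp only [eu] at m
  have q := ff_anti h0 h1 hρv hv2 hvv
  have hv12 : v1 < v2 := by nlinarith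
  have q2 := ff_anti h0 h1 hv1 hv2 hv12
  nlinarith

lemma muFn_eq : ∃ C : ℝ, 0 < C ∧ ∀ r ∈ Ioo (0:ℝ) 1, muFn a r = C * ff a (r ^ 2) := by
  refine ⟨π / (2 * sin (π * a)), ?_, ?_⟩
  · have : 0 < sin (π * a) := sin_pos_of_pos_of_lt_pi (by positivity) (by nlinarith [pi_pos])
    positivity
  · intro r hr
    have e : sqrt (1 - r^2) ^ 2 = 1 - r^2 := sq_sqrt (by nlinarith [hr.1, hr.2])
    have hK : ∀ x, ellK a x = π / 2 * GG a (x^2) := fun x => rfl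
    have hG := GG_ge_one h0 h1 (x := r^2) (by positivity) (by nlinarith [hr.1, hr.2])
    rw [muFn, hK, hK, e, ff]
    rw [mul_div_assoc, mul_div_mul_left _ _ (by positivity)]

lemma sq_mem {r : ℝ} (hr : r ∈ Ioo (0:ℝ) 1) : r ^ 2 ∈ Ioo (0:ℝ) 1 :=
  ⟨by have := hr.1; positivity, by nlinarith [hr.1, hr.2]⟩

lemma phi_spec {K r : ℝ} (hK : 0 < K) (hr : r ∈ Ioo (0:ℝ) 1) :
    phiK a K r ∈ Ioo (0:ℝ) 1 ∧ ff a (r^2) = K * ff a (phiK a K r ^ 2) := by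
  obtain ⟨C, hC, hmu⟩ := muFn_eq h0 h1
  have hex : ∃ s ∈ Ioo (0:ℝ) 1, muFn a s = muFn a r / K := by
    obtain ⟨x, hx, hx'⟩ := ff_surj h0 h1 (y := ff a (r^2) / K)
      (div_pos (ff_pos h0 h1 (sq_mem h0 h1 hr)) hK)
    have hs : sqrt x ∈ Ioo (0:ℝ) 1 :=
      ⟨sqrt_pos.2 hx.1, by rw [sqrt_lt' one_pos]; simpa using hx.2⟩
    refine ⟨sqrt x, hs, ?_⟩
    rw [hmu _ hs, hmu _ hr, sq_sqrt hx.1.le, hx', mul_div_assoc]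
  have m : phiK a K r ∈ Ioo (0:ℝ) 1 := Function.invFunOn_mem hex
  have e : muFn a (phiK a K r) = muFn a r / K := Function.invFunOn_eq hex
  refine ⟨m, ?_⟩
  rw [hmu _ m, hmu _ hr, mul_div_assoc] at e
  have := mul_left_cancel₀ hC.ne' e
  rw [this]; field_simp

lemma phi_lt {K r s : ℝ} (hK : 0 < K) (hr : r ∈ Ioo (0:ℝ) 1) (hs : s ∈ Ioo (0:ℝ) 1) (h : s < r) :
    phiK a K s < phiK a K r := by
  obtain ⟨m1, e1⟩ := phi_spec h0 h1 hK hr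
  obtain ⟨m2, e2⟩ := phi_spec h0 h1 hK hs
  by_contra! hc
  have h3 := ff_anti h0 h1 (sq_mem h0 h1 hs) (sq_mem h0 h1 hr) (by nlinarith [hs.1])
  have h4 := (ff_anti h0 h1).antitoneOn (sq_mem h0 h1 m1) (sq_mem h0 h1 m2) (by nlinarith [m1.1])
  nlinarith

lemma phi_ratio_ge {K r s : ℝ} (hK : 1 ≤ K) (hr : r ∈ Ioo (0:ℝ) 1) (hs : s ∈ Ioo (0:ℝ) 1) (h : s < r) :
    phiK a K r * s ≤ phiK a K s * r := by
  obtain ⟨m1, e1⟩ := phi_spec h0 h1 (K := K) (by linarith) hr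
  obtain ⟨m2, e2⟩ := phi_spec h0 h1 (K := K) (by linarith) hs
  have := core h0 h1 hK (sq_mem h0 h1 hs) (sq_mem h0 h1 hr) (sq_mem h0 h1 m2) (sq_mem h0 h1 m1)
    (by nlinarith [hs.1]) e2 e1
  rw [← mul_pow, ← mul_pow] at this
  exact le_of_sq_le_sq this (mul_nonneg m2.1.le hr.1.le)

lemma phi_ratio_le {K r s : ℝ} (hK0 : 0 < K) (hK : K ≤ 1) (hr : r ∈ Ioo (0:ℝ) 1)
    (hs : s ∈ Ioo (0:ℝ) 1) (h : s < r) :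
    phiK a K s * r ≤ phiK a K r * s := by
  obtain ⟨m1, e1⟩ := phi_spec h0 h1 hK0 hr
  obtain ⟨m2, e2⟩ := phi_spec h0 h1 hK0 hs
  have hl := phi_lt h0 h1 hK0 hr hs h
  have := core h0 h1 (L := K⁻¹) ((one_le_inv₀ hK0).2 hK) (sq_mem h0 h1 m2) (sq_mem h0 h1 m1)
    (sq_mem h0 h1 hs) (sq_mem h0 h1 hr)
    (by nlinarith [m2.1]) (by rw [e2]; field_simp) (by rw [e1]; field_simp)
  rw [← mul_pow, ← mul_pow] at this
  have := le_of_sq_le_sq this (mul_nonneg hs.1.le m1.1.le)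
  linarith

lemma part1 {K r s : ℝ} (hK : 1 ≤ K) (hr : r ∈ Ioo (0:ℝ) 1) (hs : s ∈ Ioo (0:ℝ) 1) (h : s < r) :
    |phiK a K r - phiK a K s| ≤ phiK a K |r - s| := by
  rw [abs_of_pos (sub_pos.2 h), abs_of_pos (sub_pos.2 (phi_lt h0 h1 (by linarith) hr hs h))]
  have hd : r - s ∈ Ioo (0:ℝ) 1 := ⟨by linarith, by linarith [hr.2, hs.1]⟩
  have q1 := phi_ratio_ge h0 h1 hK hr hs h
  have q2 := phi_ratio_ge h0 h1 hK hr hd (by linarith [hs.1])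
  have : phiK a K r * r ≤ (phiK a K s + phiK a K (r - s)) * r := by linarith
  have := le_of_mul_le_mul_right this hr.1
  linarith

lemma part2 {K r s : ℝ} (hK0 : 0 < K) (hK : K ≤ 1) (hr : r ∈ Ioo (0:ℝ) 1) (hs : s ∈ Ioo (0:ℝ) 1)
    (h : s < r) : phiK a K |r - s| ≤ |phiK a K r - phiK a K s| := by
  rw [abs_of_pos (sub_pos.2 h), abs_of_pos (sub_pos.2 (phi_lt h0 h1 (by linarith) hr hs h))]
  have hd : r - s ∈ Ioo (0:ℝ) 1 := ⟨by linarith, by linarith [hr.2, hs.1]⟩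
  have q1 := phi_ratio_le h0 h1 hK0 hK hr hs h
  have q2 := phi_ratio_le h0 h1 hK0 hK hr hd (by linarith [hs.1])
  have : (phiK a K s + phiK a K (r - s)) * r ≤ phiK a K r * r := by linarith
  have := le_of_mul_le_mul_right this hr.1
  linarith

end

theorem stmt9 (a : ℝ) (ha : a ∈ Set.Ioc (0:ℝ) (1/2)) :
    (∀ K : ℝ, 1 ≤ K → ∀ r s : ℝ, r ∈ Set.Ioo (0:ℝ) 1 → s ∈ Set.Ioo (0:ℝ) 1 →
      r ≠ s → |r - s| ∈ Set.Ioo (0:ℝ) 1 →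
      |phiK a K r - phiK a K s| ≤ phiK a K (|r - s|)) ∧
    (∀ K : ℝ, 0 < K → K ≤ 1 → ∀ r s : ℝ, r ∈ Set.Ioo (0:ℝ) 1 → s ∈ Set.Ioo (0:ℝ) 1 →
      r ≠ s → |r - s| ∈ Set.Ioo (0:ℝ) 1 →
      |phiK a K r - phiK a K s| ≥ phiK a K (|r - s|)) := by
  refine ⟨fun K hK r s hr hs hne _ => ?_, fun K hK0 hK r s hr hs hne _ => ?_⟩
  · rcases lt_or_gt_of_ne hne with h | h
    · rw [abs_sub_comm, abs_sub_comm r s]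
      exact part1 ha.1 ha.2 hK hs hr h
    · exact part1 ha.1 ha.2 hK hr hs h
  · rcases lt_or_gt_of_ne hne with h | h
    · rw [abs_sub_comm, abs_sub_comm r s]
      exact part2 ha.1 ha.2 hK0 hK hs hr h
    · exact part2 ha.1 ha.2 hK0 hK hr hs h
end

section
/- For every a ∈ (0,1/2] and every c ∈ [-3, 0), the function f(r) = 𝒦_a(r)^c + 𝒦'_a(r)^c is strictly increasing from (0, 1/√2) onto ((π/2)^c, 2·𝒦_a(1/√2)^c), where 𝒦'_a(r) = 𝒦_a(√(1-r²)). -/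
open Real Set

namespace S15
open Filter Topology

noncomputable def cf (a : ℝ) (n : ℕ) : ℝ :=
  shiftedFact a n * shiftedFact (1 - a) n / (shiftedFact 1 n * (Nat.factorial n : ℝ))

lemma sf_one (n : ℕ) : shiftedFact 1 n = (Nat.factorial n : ℝ) := by
  induction n with
  | zero => simp [shiftedFact]
  | succ k ih => rw [shiftedFact, ih, Nat.factorial_succ]; push_cast; ring

lemma cf_zero (a : ℝ) : cf a 0 = 1 := by simp [cf, shiftedFact]

lemma cf_succ (a : ℝ) (n : ℕ) :
    ((n : ℝ) + 1) ^ 2 * cf a (n + 1) = ((n : ℝ) ^ 2 + n + a * (1 - a)) * cf a n := by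
  have h : (Nat.factorial n : ℝ) ≠ 0 := by positivity
  simp only [cf, sf_one, shiftedFact, Nat.factorial_succ]
  push_cast
  field_simp
  ring

lemma cf_pos {a : ℝ} (h0 : 0 < a) (h1 : a < 1) (n : ℕ) : 0 < cf a n := by
  induction n with
  | zero => simp [cf_zero]
  | succ k ih =>
    have := cf_succ a k
    have hb : 0 < a * (1 - a) := mul_pos h0 (by linarith)
    have h2 : 0 < ((k : ℝ) + 1) ^ 2 * cf a (k + 1) := by rw [this]; positivity
    exact pos_of_mul_pos_right h2 (by positivity)

lemma cf_le_one {a : ℝ} (h0 : 0 < a) (h1 : a < 1) (n : ℕ) : cf a n ≤ 1 := by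
  induction n with
  | zero => simp [cf_zero]
  | succ k ih =>
    have e := cf_succ a k
    have hb : 0 < a * (1 - a) := mul_pos h0 (by linarith)
    have hb1 : a * (1 - a) ≤ 1 := by nlinarith
    have hk : (0:ℝ) ≤ k := by positivity
    have hp := cf_pos h0 h1 k
    have : ((k : ℝ) + 1) ^ 2 * cf a (k + 1) ≤ ((k : ℝ) + 1) ^ 2 * 1 := by
      rw [e]
      calc _ ≤ ((k : ℝ) ^ 2 + k + a * (1 - a)) * 1 := by gcongr
        _ ≤ _ := by nlinarith
    exact le_of_mul_le_mul_left this (by positivity)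

lemma cf_lower {a : ℝ} (h0 : 0 < a) (h1 : a < 1) (n : ℕ) :
    a * (1 - a) ≤ ((n : ℝ) + 1) * cf a (n + 1) := by
  induction n with
  | zero => have := cf_succ a 0; simp [cf_zero] at this ⊢; linarith
  | succ k ih =>
    have e := cf_succ a (k + 1)
    have hb : 0 < a * (1 - a) := mul_pos h0 (by linarith)
    have hp := cf_pos h0 h1 (k + 1)
    push_cast at e ⊢
    have hk : (0:ℝ) ≤ k := by positivity
    have : ((k : ℝ) + 1 + 1) * (((k : ℝ) + 1) * cf a (k + 1)) ≤
        ((k : ℝ) + 1 + 1) * (((k : ℝ) + 1 + 1) * cf a (k + 1 + 1)) := by nlinarith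
    exact ih.trans (le_of_mul_le_mul_left this (by positivity))

lemma sum_of_bdd {d : ℕ → ℝ} (hd : ∀ n, |d n| ≤ 1) {x : ℝ} (hx : |x| < 1) :
    Summable (fun n => d n * x ^ n) := by
  refine Summable.of_norm_bounded (g := fun n => |x| ^ n)
    (summable_geometric_of_lt_one (abs_nonneg x) hx) (fun n => ?_)
  rw [norm_mul, norm_pow, Real.norm_eq_abs, Real.norm_eq_abs]
  exact mul_le_of_le_one_left (by positivity) (hd n)

lemma sum_of_bdd' {d : ℕ → ℝ} (hd : ∀ n, |d n| ≤ 1) {x : ℝ} (hx : |x| < 1) :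
    Summable (fun n : ℕ => d n * ((n : ℝ) * x ^ (n - 1))) := by
  have hs : Summable (fun n : ℕ => (n : ℝ) * |x| ^ (n - 1)) := by
    rw [← summable_nat_add_iff 1]
    have h1 := summable_pow_mul_geometric_of_norm_lt_one (R := ℝ) 1 (r := |x|) (by simpa using hx)
    have h2 := summable_geometric_of_lt_one (abs_nonneg x) hx
    refine (h1.add h2).congr (fun n => ?_)
    simp
    ring
  refine Summable.of_norm_bounded hs (fun n => ?_)
  rw [norm_mul, norm_mul, norm_pow, Real.norm_eq_abs, Real.norm_eq_abs, Real.norm_eq_abs,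
    Nat.abs_cast]
  exact mul_le_of_le_one_left (by positivity) (hd n)

lemma deriv_ps {d : ℕ → ℝ} (hd : ∀ n, |d n| ≤ 1) {x : ℝ} (hx : |x| < 1) :
    HasDerivAt (fun y => ∑' n, d n * y ^ n) (∑' n : ℕ, d n * ((n : ℝ) * x ^ (n - 1))) x := by
  obtain ⟨ρ, h1, h2⟩ := exists_between hx
  have hρ : 0 < ρ := (abs_nonneg x).trans_lt h1
  have hu := sum_of_bdd' (d := fun _ => 1) (by simp) (x := ρ) (by rwa [abs_of_pos hρ])
  refine hasDerivAt_tsum_of_isPreconnected (t := Ioo (-ρ) ρ) (y₀ := 0) hu isOpen_Ioo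
    isPreconnected_Ioo (fun n y _ => (hasDerivAt_pow n y).const_mul (d n)) (fun n y hy => ?_)
    ⟨by linarith, hρ⟩ (sum_of_bdd hd (by simp)) (abs_lt.1 h1)
  have hy' : |y| ≤ ρ := (abs_lt.2 hy).le
  rw [norm_mul, norm_mul, norm_pow, Real.norm_eq_abs, Real.norm_eq_abs, Real.norm_eq_abs,
    Nat.abs_cast]
  gcongr
  exact hd n

noncomputable def F (a x : ℝ) : ℝ := ∑' n, cf a n * x ^ n
noncomputable def dd (a : ℝ) : ℕ → ℝ
  | 0 => 0
  | n + 1 => cf a n / ((n : ℝ) + 1)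
noncomputable def L (a x : ℝ) : ℝ := ∑' n, dd a n * x ^ n

variable {a : ℝ}

lemma cf_abs (h0 : 0 < a) (h1 : a < 1) (n : ℕ) : |cf a n| ≤ 1 := by
  rw [abs_of_pos (cf_pos h0 h1 n)]; exact cf_le_one h0 h1 n

lemma dd_abs (h0 : 0 < a) (h1 : a < 1) (n : ℕ) : |dd a n| ≤ 1 := by
  cases n with
  | zero => simp [dd]
  | succ k =>
    have := cf_pos h0 h1 k
    rw [dd, abs_of_pos (by positivity), div_le_one (by positivity)]
    have := cf_le_one h0 h1 k
    have hk : (0:ℝ) ≤ k := by positivity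
    linarith

lemma L_deriv (h0 : 0 < a) (h1 : a < 1) {x : ℝ} (hx : |x| < 1) :
    HasDerivAt (L a) (F a x) x := by
  suffices h : F a x = ∑' n : ℕ, dd a n * ((n : ℝ) * x ^ (n - 1)) by
    rw [h]; exact deriv_ps (dd_abs h0 h1) hx
  rw [(sum_of_bdd' (dd_abs h0 h1) hx).tsum_eq_zero_add, F]
  simp only [dd, zero_mul, zero_add]
  refine tsum_congr (fun n => ?_)
  push_cast
  have : (n : ℝ) + 1 ≠ 0 := by positivity
  field_simp

lemma L_eq (h0 : 0 < a) (h1 : a < 1) {x : ℝ} (hx : |x| < 1) :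
    HasSum (fun n : ℕ => cf a n / ((n : ℝ) + 1) * x ^ (n + 1)) (L a x) := by
  have h := sum_of_bdd (dd_abs h0 h1) hx
  have e := h.tsum_eq_zero_add
  rw [L, e, show dd a 0 = 0 from rfl, zero_mul, zero_add]
  exact ((summable_nat_add_iff 1).2 h).hasSum

lemma F_deriv (h0 : 0 < a) (h1 : a < 1) {x : ℝ} (hx : |x| < 1) (hx0 : x ≠ 0) :
    HasDerivAt (F a) (a * (1 - a) * L a x / (x * (1 - x))) x := by
  have hx1 : 1 - x ≠ 0 := by have := (abs_lt.1 hx).2; linarith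
  suffices h : a * (1 - a) * L a x / (x * (1 - x)) =
      ∑' n : ℕ, cf a n * ((n : ℝ) * x ^ (n - 1)) by
    rw [h]; exact deriv_ps (cf_abs h0 h1) hx
  have hs := sum_of_bdd' (cf_abs h0 h1) hx
  have hs1 := (summable_nat_add_iff 1).2 hs
  rw [div_eq_iff (by positivity)]
  set P := ∑' n : ℕ, cf a n * ((n : ℝ) * x ^ (n - 1)) with hP
  have e1 : HasSum (fun n : ℕ => cf a (n + 1) * (((n : ℝ) + 1) * x ^ n)) P := by
    have := hs1.hasSum
    have e := hs.tsum_eq_zero_add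
    simp only [Nat.cast_zero, zero_mul, mul_zero, zero_add] at e
    rw [hP, e]
    simpa using this
  have e2 := hs.hasSum
  rw [← hP] at e2
  have e3 := (e1.mul_left x).sub (e2.mul_left (x ^ 2))
  have e4 := (L_eq h0 h1 hx).mul_left (a * (1 - a))
  have hfun : (fun n : ℕ => a * (1 - a) * (cf a n / ((n : ℝ) + 1) * x ^ (n + 1))) =
      fun n : ℕ => x * (cf a (n + 1) * (((n : ℝ) + 1) * x ^ n)) -
        x ^ 2 * (cf a n * ((n : ℝ) * x ^ (n - 1))) := by
    funext n
    have hn : (n : ℝ) + 1 ≠ 0 := by positivity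
    have e5 : x ^ 2 * (cf a n * ((n : ℝ) * x ^ (n - 1))) = n * cf a n * x ^ (n + 1) := by
      cases n with
      | zero => simp
      | succ k => simp only [Nat.add_sub_cancel]; ring
    have e6 : cf a (n + 1) = ((n : ℝ) ^ 2 + n + a * (1 - a)) * cf a n / ((n : ℝ) + 1) ^ 2 := by
      rw [eq_div_iff (by positivity), ← cf_succ]; ring
    rw [e5, e6]
    field_simp
    ring
  rw [hfun] at e4
  rw [e4.unique e3]
  ring

lemma F_pos (h0 : 0 < a) (h1 : a < 1) {x : ℝ} (hx0 : 0 ≤ x) (hx : x < 1) : 0 < F a x := by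
  have hx' : |x| < 1 := by rwa [abs_of_nonneg hx0]
  refine (sum_of_bdd (cf_abs h0 h1) hx').tsum_pos (fun n => ?_) 0 ?_
  · have := cf_pos h0 h1 n; positivity
  · simp [cf_zero]

lemma F_strict (h0 : 0 < a) (h1 : a < 1) {x y : ℝ} (hx0 : 0 ≤ x) (hxy : x < y) (hy : y < 1) :
    F a x < F a y := by
  refine Summable.tsum_lt_tsum (i := 1) (fun n => ?_) ?_
    (sum_of_bdd (cf_abs h0 h1) ?_) (sum_of_bdd (cf_abs h0 h1) ?_)
  · have := cf_pos h0 h1 n; gcongr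
  · have := cf_pos h0 h1 1; simp only [pow_one]; gcongr
  · rw [abs_of_nonneg hx0]; linarith
  · rw [abs_of_nonneg (by linarith)]; linarith

lemma L_pos (h0 : 0 < a) (h1 : a < 1) {x : ℝ} (hx0 : 0 < x) (hx : x < 1) : 0 < L a x := by
  have hx' : |x| < 1 := by rwa [abs_of_pos hx0]
  have h := L_eq h0 h1 hx'
  rw [← h.tsum_eq]
  refine h.summable.tsum_pos (fun n => ?_) 0 ?_
  · have := cf_pos h0 h1 n; positivity
  · simpa [cf_zero]

lemma L_lt (h0 : 0 < a) (h1 : a < 1) {x : ℝ} (hx0 : 0 < x) (hx : x < 1) : L a x < x * F a x := by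
  have hx' : |x| < 1 := by rwa [abs_of_pos hx0]
  have h := L_eq h0 h1 hx'
  rw [← h.tsum_eq, F, ← tsum_mul_left]
  refine Summable.tsum_lt_tsum (i := 1) (fun n => ?_) ?_ h.summable
    ((sum_of_bdd (cf_abs h0 h1) hx').mul_left x)
  · have := cf_pos h0 h1 n
    rw [pow_succ]
    have : cf a n / ((n : ℝ) + 1) ≤ cf a n := div_le_self this.le (by simp)
    calc _ ≤ cf a n * (x ^ n * x) := by gcongr
      _ = _ := by ring
  · have := cf_pos h0 h1 1
    have h3 : 0 < cf a 1 * x ^ 2 := by positivity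
    norm_num
    nlinarith

lemma F_lower (h0 : 0 < a) (h1 : a < 1) {x : ℝ} (hx0 : 0 ≤ x) (hx : x < 1) :
    a * (1 - a) * (- Real.log (1 - x)) ≤ F a x := by
  have hx' : |x| < 1 := by rwa [abs_of_nonneg hx0]
  have hl := (Real.hasSum_pow_div_log_of_abs_lt_one hx').mul_left (a * (1 - a))
  have hs := sum_of_bdd (cf_abs h0 h1) hx'
  rw [F, hs.tsum_eq_zero_add]
  have : a * (1 - a) * (- Real.log (1 - x)) ≤ ∑' n, cf a (n + 1) * x ^ (n + 1) := by
    rw [← hl.tsum_eq]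
    refine hl.summable.tsum_le_tsum (fun n => ?_) ((summable_nat_add_iff 1).2 hs)
    have := cf_lower h0 h1 n
    have h3 : a * (1 - a) / ((n : ℝ) + 1) ≤ cf a (n + 1) := by
      rw [div_le_iff₀ (by positivity)]; linarith
    calc _ = a * (1 - a) / ((n : ℝ) + 1) * x ^ (n + 1) := by ring
      _ ≤ _ := by gcongr
  simp [cf_zero]
  linarith

lemma F_cont (h0 : 0 < a) (h1 : a < 1) {x : ℝ} (hx : |x| < 1) : ContinuousAt (F a) x :=
  (deriv_ps (cf_abs h0 h1) hx).continuousAt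

noncomputable def Q (a x : ℝ) : ℝ :=
  Real.log (L a (1 - x)) + 4 * Real.log (F a x) - Real.log (L a x) - 4 * Real.log (F a (1 - x))

lemma refl_deriv {f : ℝ → ℝ} {f' x : ℝ} (h : HasDerivAt f f' (1 - x)) :
    HasDerivAt (fun y => f (1 - y)) (-f') x := by
  have h2 : HasDerivAt (fun y : ℝ => 1 - y) (-1) x := by
    simpa using (hasDerivAt_id x).const_sub 1
  have h3 := HasDerivAt.comp x h h2
  rw [mul_neg_one] at h3
  exact h3

lemma Q_deriv (h0 : 0 < a) (h1 : a < 1) {x : ℝ} (hx0 : 0 < x) (hx : x < 1) :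
    ∃ q, q < 0 ∧ HasDerivAt (Q a) q x := by
  have hy0 : 0 < 1 - x := by linarith
  have hy : 1 - x < 1 := by linarith
  have hx' : |x| < 1 := by rwa [abs_of_pos hx0]
  have hy' : |1 - x| < 1 := by rwa [abs_of_pos hy0]
  have u0 := F_pos h0 h1 hx0.le hx
  have v0 := F_pos h0 h1 hy0.le hy
  have l0 := L_pos h0 h1 hx0 hx
  have m0 := L_pos h0 h1 hy0 hy
  have l1 := L_lt h0 h1 hx0 hx
  have m1 := L_lt h0 h1 hy0 hy
  have d1 := (refl_deriv (L_deriv h0 h1 hy')).log m0.ne'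
  have d2 := ((F_deriv h0 h1 hx' hx0.ne').log u0.ne').const_mul 4
  have d3 := (L_deriv h0 h1 hx').log l0.ne'
  have d4 := ((refl_deriv (F_deriv h0 h1 hy' hy0.ne')).log v0.ne').const_mul 4
  refine ⟨_, ?_, ((d1.add d2).sub d3).sub d4⟩
  set u := F a x
  set v := F a (1 - x)
  set l := L a x
  set m := L a (1 - x)
  have hb4 : 4 * (a * (1 - a)) ≤ 1 := by nlinarith [sq_nonneg (2 * a - 1)]
  have hb : 0 < a * (1 - a) := mul_pos h0 (by linarith)
  set b := a * (1 - a)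
  have key : 4 * b * (l * m) < x * (1 - x) * u * v := by
    calc 4 * b * (l * m) ≤ 1 * (l * m) := by gcongr
      _ = l * m := one_mul _
      _ < (x * u) * ((1 - x) * v) := by gcongr
      _ = _ := by ring
  have e : -v / m + 4 * (b * l / (x * (1 - x)) / u) - u / l -
      4 * (-(b * m / ((1 - x) * (1 - (1 - x)))) / v) =
      (l * v + m * u) * ((4 * b * (l * m) - x * (1 - x) * u * v) /
        (l * m * (x * (1 - x) * u * v))) := by
    rw [sub_sub_cancel]
    field_simp
    ring
  rw [e]
  refine mul_neg_of_pos_of_neg (by positivity) (div_neg_of_neg_of_pos (by linarith) (by positivity))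

lemma Q_pos (h0 : 0 < a) (h1 : a < 1) {x : ℝ} (hx0 : 0 < x) (hx : x < 1 / 2) : 0 < Q a x := by
  have hanti : StrictAntiOn (Q a) (Ioo 0 1) := by
    refine strictAntiOn_of_deriv_neg (convex_Ioo 0 1) (fun y hy => ?_) (fun y hy => ?_)
    · obtain ⟨q, _, h⟩ := Q_deriv h0 h1 hy.1 hy.2
      exact h.continuousAt.continuousWithinAt
    · rw [interior_Ioo] at hy
      obtain ⟨q, hq, h⟩ := Q_deriv h0 h1 hy.1 hy.2
      rwa [h.deriv]
  have := hanti ⟨hx0, by linarith⟩ (show (1/2 : ℝ) ∈ Ioo (0:ℝ) 1 by norm_num) hx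
  have e : Q a (1/2) = 0 := by simp only [Q]; norm_num
  linarith

noncomputable def g (a c x : ℝ) : ℝ := (π / 2 * F a x) ^ c + (π / 2 * F a (1 - x)) ^ c

lemma g_cont (h0 : 0 < a) (h1 : a < 1) {c x : ℝ} (hx0 : 0 < x) (hx : x < 1) :
    ContinuousAt (g a c) x := by
  have hy0 : 0 < 1 - x := by linarith
  have hx' : |x| < 1 := by rwa [abs_of_pos hx0]
  have hy' : |1 - x| < 1 := by rw [abs_of_pos hy0]; linarith
  have u0 := F_pos h0 h1 hx0.le hx
  have v0 := F_pos h0 h1 hy0.le (by linarith)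
  have c1 : ContinuousAt (fun y => F a (1 - y)) x :=
    ContinuousAt.comp (f := fun y : ℝ => 1 - y) (F_cont h0 h1 hy') (by fun_prop)
  have hpi := Real.pi_pos
  refine ContinuousAt.add ?_ ?_
  · exact (continuousAt_const.mul (F_cont h0 h1 hx')).rpow_const
      (Or.inl (show π / 2 * F a x ≠ 0 by positivity))
  · exact (continuousAt_const.mul c1).rpow_const
      (Or.inl (show π / 2 * F a (1 - x) ≠ 0 by positivity))

lemma g_deriv (h0 : 0 < a) (h1 : a < 1) {c x : ℝ} (hc : -3 ≤ c) (hc0 : c < 0)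
    (hx0 : 0 < x) (hx : x < 1 / 2) : 0 < deriv (g a c) x := by
  have hy0 : 0 < 1 - x := by linarith
  have hy : 1 - x < 1 := by linarith
  have hx' : |x| < 1 := by rw [abs_of_pos hx0]; linarith
  have hy' : |1 - x| < 1 := by rwa [abs_of_pos hy0]
  have u0 := F_pos h0 h1 hx0.le (by linarith)
  have v0 := F_pos h0 h1 hy0.le hy
  have uv := F_strict h0 h1 hx0.le (show x < 1 - x by linarith) hy
  have l0 := L_pos h0 h1 hx0 (by linarith)
  have m0 := L_pos h0 h1 hy0 hy
  have hpi : 0 < π / 2 := by positivity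
  have hQ := Q_pos h0 h1 hx0 hx
  have d1 := ((F_deriv h0 h1 hx' hx0.ne').const_mul (π / 2)).rpow_const (p := c)
    (Or.inl (by positivity))
  have d2 := ((refl_deriv (F_deriv h0 h1 hy' hy0.ne')).const_mul (π / 2)).rpow_const (p := c)
    (Or.inl (by positivity))
  have d : HasDerivAt (g a c) _ x := d1.add d2
  rw [d.deriv]
  rw [sub_sub_cancel]
  unfold Q at hQ
  have hb : 0 < a * (1 - a) := mul_pos h0 (by linarith)
  have key : L a x * (π / 2 * F a x) ^ (c - 1) < L a (1 - x) * (π / 2 * F a (1 - x)) ^ (c - 1) := by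
    rw [← Real.log_lt_log_iff (by positivity) (by positivity), Real.log_mul (by positivity) (by positivity),
      Real.log_mul (by positivity) (by positivity), Real.log_rpow (by positivity),
      Real.log_rpow (by positivity), Real.log_mul (by positivity) (by positivity),
      Real.log_mul (by positivity) (by positivity)]
    have := Real.log_lt_log u0 uv
    nlinarith
  have e : ∀ l m U V b p : ℝ, p * (b * l / (x * (1 - x))) * c * U
      + p * -(b * m / ((1 - x) * x)) * c * V = p * b * (-c) / (x * (1 - x)) * (m * V - l * U) := by
    intros; field_simp; ring
  rw [e]
  have : 0 < -c := by linarith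
  have := sub_pos.2 key
  positivity

lemma g_mono (h0 : 0 < a) (h1 : a < 1) {c : ℝ} (hc : -3 ≤ c) (hc0 : c < 0) :
    StrictMonoOn (g a c) (Ioc 0 (1/2)) := by
  refine strictMonoOn_of_deriv_pos (convex_Ioc 0 (1/2)) (fun y hy => ?_) (fun y hy => ?_)
  · exact (g_cont h0 h1 hy.1 (by linarith [hy.2])).continuousWithinAt
  · rw [interior_Ioc] at hy
    exact g_deriv h0 h1 hc hc0 hy.1 hy.2

lemma g_lim (h0 : 0 < a) (h1 : a < 1) {c : ℝ} (hc0 : c < 0) :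
    Tendsto (g a c) (𝓝[>] 0) (𝓝 ((π / 2) ^ c)) := by
  have hb : 0 < a * (1 - a) := mul_pos h0 (by linarith)
  have hpi : 0 < π / 2 := by positivity
  have F0 : F a 0 = 1 := by
    rw [F, tsum_eq_single 0]
    · simp [cf_zero]
    · intro n hn; simp [hn]
  have t1 : Tendsto (fun x => (π / 2 * F a x) ^ c) (𝓝[>] 0) (𝓝 ((π / 2) ^ c)) := by
    have h : ContinuousAt (fun x => (π / 2 * F a x) ^ c) 0 :=
      (continuousAt_const.mul (F_cont h0 h1 (by simp))).rpow_const (Or.inl (show π / 2 * F a 0 ≠ 0 by rw [F0]; positivity))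
    have h2 := h.tendsto
    simp only [F0, mul_one] at h2
    exact h2.mono_left nhdsWithin_le_nhds
  have t2 : Tendsto (fun x => F a (1 - x)) (𝓝[>] 0) atTop := by
    have hl : Tendsto (fun x : ℝ => a * (1 - a) * (- Real.log x)) (𝓝[>] 0) atTop :=
      (tendsto_neg_atBot_atTop.comp Real.tendsto_log_nhdsGT_zero).const_mul_atTop hb
    refine tendsto_atTop_mono' _ ?_ hl
    filter_upwards [Ioo_mem_nhdsGT (show (0:ℝ) < 1 by norm_num)] with x hx
    have := F_lower h0 h1 (x := 1 - x) (by linarith [hx.2]) (by linarith [hx.1])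
    rwa [sub_sub_cancel] at this
  have t3 : Tendsto (fun x => (π / 2 * F a (1 - x)) ^ c) (𝓝[>] 0) (𝓝 0) := by
    have := tendsto_rpow_neg_atTop (y := -c) (by linarith)
    rw [neg_neg] at this
    exact this.comp (t2.const_mul_atTop hpi)
  have t4 := t1.add t3
  rw [add_zero] at t4
  exact t4

lemma g_image (h0 : 0 < a) (h1 : a < 1) {c : ℝ} (hc : -3 ≤ c) (hc0 : c < 0) :
    g a c '' (Ioo 0 (1/2)) = Ioo ((π / 2) ^ c) (g a c (1/2)) := by
  have hm := g_mono h0 h1 hc hc0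
  apply Subset.antisymm
  · rintro _ ⟨x, hx, rfl⟩
    refine ⟨?_, hm ⟨hx.1, hx.2.le⟩ ⟨by norm_num, le_rfl⟩ hx.2⟩
    have h2 : g a c (x / 2) < g a c x :=
      hm ⟨by linarith [hx.1], by linarith [hx.1, hx.2]⟩ ⟨hx.1, hx.2.le⟩ (by linarith [hx.1])
    refine lt_of_le_of_lt (le_of_tendsto (g_lim h0 h1 hc0) ?_) h2
    filter_upwards [Ioo_mem_nhdsGT (show (0:ℝ) < x / 2 by linarith [hx.1])] with y hy
    exact (hm ⟨hy.1, by linarith [hy.2, hx.1, hx.2]⟩ ⟨by linarith [hx.1], by linarith [hx.1, hx.2]⟩ hy.2).le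
  · have hhalf : Tendsto (g a c) (𝓝[<] (1/2)) (𝓝 (g a c (1/2))) :=
      (g_cont h0 h1 (by norm_num) (by norm_num)).tendsto.mono_left nhdsWithin_le_nhds
    refine isPreconnected_Ioo.intermediate_value_Ioo (l₁ := 𝓝[>] 0) (l₂ := 𝓝[<] (1/2))
      ?_ ?_ ?_ (g_lim h0 h1 hc0) hhalf
    · exact le_principal_iff.2 (Ioo_mem_nhdsGT (by norm_num))
    · exact le_principal_iff.2 (Ioo_mem_nhdsLT (by norm_num))
    · intro y hy
      exact (g_cont h0 h1 hy.1 (by linarith [hy.2])).continuousWithinAt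

lemma ellK_eq (a r : ℝ) : ellK a r = π / 2 * F a (r ^ 2) := rfl

end S15

theorem stmt15 (a : ℝ) (ha : a ∈ Set.Ioc (0:ℝ) (1/2)) (c : ℝ) (hc : c ∈ Set.Ico (-3:ℝ) 0) :
    StrictMonoOn (fun r : ℝ => (ellK a r) ^ c + (ellK a (Real.sqrt (1 - r ^ 2))) ^ c)
      (Set.Ioo 0 (1 / Real.sqrt 2)) ∧
    (fun r : ℝ => (ellK a r) ^ c + (ellK a (Real.sqrt (1 - r ^ 2))) ^ c) ''
        (Set.Ioo 0 (1 / Real.sqrt 2)) =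
      Set.Ioo ((Real.pi / 2) ^ c) (2 * (ellK a (1 / Real.sqrt 2)) ^ c) := by
  have h0 : 0 < a := ha.1
  have h1 : a < 1 := by linarith [ha.2]
  have hs2 : (1 / Real.sqrt 2) ^ 2 = 1 / 2 := by rw [div_pow, Real.sq_sqrt (by norm_num)]; norm_num
  have hsp : 0 < 1 / Real.sqrt 2 := by positivity
  have hsq : ∀ r ∈ Set.Ioo 0 (1 / Real.sqrt 2), r ^ 2 ∈ Set.Ioo (0:ℝ) (1 / 2) := by
    intro r hr
    refine ⟨pow_pos hr.1 2, ?_⟩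
    rw [← hs2]
    exact pow_lt_pow_left₀ hr.2 hr.1.le (by norm_num)
  have hf : ∀ r ∈ Set.Ioo 0 (1 / Real.sqrt 2),
      (ellK a r) ^ c + (ellK a (Real.sqrt (1 - r ^ 2))) ^ c = S15.g a c (r ^ 2) := by
    intro r hr
    have := (hsq r hr).2
    rw [S15.ellK_eq, S15.ellK_eq, Real.sq_sqrt (by linarith), S15.g]
  constructor
  · intro r hr s hs hrs
    simp only
    rw [hf r hr, hf s hs]
    exact S15.g_mono h0 h1 hc.1 hc.2 ⟨(hsq r hr).1, (hsq r hr).2.le⟩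
      ⟨(hsq s hs).1, (hsq s hs).2.le⟩ (pow_lt_pow_left₀ hrs hr.1.le (by norm_num))
  · have e : 2 * (ellK a (1 / Real.sqrt 2)) ^ c = S15.g a c (1/2) := by
      rw [S15.ellK_eq, hs2, S15.g]; norm_num; ring
    rw [e, ← S15.g_image h0 h1 hc.1 hc.2, Set.image_congr hf]
    ext y
    constructor
    · rintro ⟨r, hr, rfl⟩
      exact ⟨r ^ 2, hsq r hr, rfl⟩
    · rintro ⟨x, hx, rfl⟩
      refine ⟨Real.sqrt x, ⟨Real.sqrt_pos.2 hx.1, ?_⟩, ?_⟩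
      · rw [Real.sqrt_lt hx.1.le hsp.le, hs2]; exact hx.2
      · simp only
        rw [Real.sq_sqrt hx.1.le]
end

section
/- Let a ∈ (0,1/2]. Then: (1) the function K ↦ (log λ_a(K))/(K - 1/K) is strictly increasing from (1,∞) onto (2·𝒦_a(1/√2)²/(π·sin(πa)), π/sin(πa)); (2) the function K ↦ log(λ_a(K) + 1) is convex on (0,∞) and K ↦ log(λ_a(K)) is concave on (0,∞); (3) the function K ↦ (log λ_a(K))/log K is strictly increasing on (1,∞), and in particular λ_a(K^c) < (λ_a(K))^c for all K > 1 and c ∈ (0,1). -/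
open Real Set

open Filter Topology

/-- coefficients -/
noncomputable def cf (a : ℝ) (n : ℕ) : ℝ :=
  shiftedFact a n * shiftedFact (1 - a) n / (shiftedFact 1 n * (Nat.factorial n : ℝ))

noncomputable def cF (a x : ℝ) : ℝ := ∑' n : ℕ, cf a n * x ^ n
noncomputable def cH (a x : ℝ) : ℝ := ∑' n : ℕ, cf a n / (n + 1) * x ^ n
noncomputable def cH1 (a x : ℝ) : ℝ := ∑' n : ℕ, n * (cf a n / (n + 1)) * x ^ (n - 1)

lemma ser_summable (c : ℕ → ℝ) (hc : ∀ n, |c n| ≤ 1) (x : ℝ) (hx : |x| < 1) :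
    Summable (fun n : ℕ => c n * x ^ n) := by
  refine Summable.of_norm_bounded (summable_geometric_of_lt_one (abs_nonneg x) hx) ?_
  intro n
  rw [norm_mul, norm_pow]
  simp only [Real.norm_eq_abs]
  have : 0 ≤ |x| ^ n := by positivity
  nlinarith [hc n]

lemma ser_summable' (x : ℝ) (hx0 : 0 ≤ x) (hx : x < 1) :
    Summable (fun n : ℕ => (n : ℝ) * x ^ (n - 1)) := by
  rw [← summable_nat_add_iff 1]
  have h1 := summable_pow_mul_geometric_of_norm_lt_one 1 (r := x) (by rwa [Real.norm_eq_abs, abs_of_nonneg hx0])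
  have h2 := summable_geometric_of_lt_one hx0 hx
  refine (h1.add h2).congr ?_
  intro n
  simp
  ring

lemma ser_summable1 (c : ℕ → ℝ) (hc : ∀ n, |c n| ≤ 1) (x : ℝ) (hx : |x| < 1) :
    Summable (fun n : ℕ => n * c n * x ^ (n - 1)) := by
  refine Summable.of_norm_bounded (ser_summable' |x| (abs_nonneg x) hx) ?_
  intro n
  rw [norm_mul, norm_pow, norm_mul]
  simp only [Real.norm_eq_abs, Nat.abs_cast]
  have : 0 ≤ |x| ^ (n - 1) := by positivity
  have h2 : (n : ℝ) * |c n| ≤ n := by nlinarith [hc n, (Nat.cast_nonneg n : (0:ℝ) ≤ n)]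
  nlinarith

lemma ser_deriv (c : ℕ → ℝ) (hc : ∀ n, |c n| ≤ 1) (x : ℝ) (hx : |x| < 1) :
    HasDerivAt (fun z => ∑' n : ℕ, c n * z ^ n) (∑' n : ℕ, n * c n * x ^ (n - 1)) x := by
  obtain ⟨r, hr1, hr2⟩ := exists_between hx
  have hr0 : 0 ≤ r := (abs_nonneg x).trans hr1.le
  refine hasDerivAt_tsum_of_isPreconnected (t := Ioo (-r) r) (y₀ := x) (ser_summable' r hr0 hr2)
    isOpen_Ioo isPreconnected_Ioo (g := fun n z => c n * z ^ n) (g' := fun n z => n * c n * z ^ (n - 1)) ?_ ?_ ?_ ?_ ?_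
  · intro n y hy
    have := (hasDerivAt_pow n y).const_mul (c n)
    convert! this using 1
    ring
  · intro n y hy
    rw [norm_mul, norm_pow, norm_mul]
    simp only [Real.norm_eq_abs, Nat.abs_cast]
    have hy' : |y| ≤ r := (abs_lt.2 hy).le
    have h1 : |y| ^ (n - 1) ≤ r ^ (n - 1) := pow_le_pow_left₀ (abs_nonneg y) hy' _
    have h2 : (n : ℝ) * |c n| ≤ n := by nlinarith [hc n, (Nat.cast_nonneg n : (0:ℝ) ≤ n)]
    exact mul_le_mul h2 h1 (by positivity) (by positivity)
  · exact abs_lt.1 hr1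
  · exact ser_summable c hc x hx
  · exact abs_lt.1 hr1

lemma sf_one (n : ℕ) : shiftedFact 1 n = n.factorial := by
  induction n with
  | zero => simp [shiftedFact]
  | succ n ih => rw [shiftedFact, ih, Nat.factorial_succ]; push_cast; ring

lemma sf_pos (a : ℝ) (ha : 0 < a) (n : ℕ) : 0 < shiftedFact a n := by
  induction n with
  | zero => simp [shiftedFact]
  | succ n ih => rw [shiftedFact]; positivity

lemma sf_prod (a : ℝ) (n : ℕ) : shiftedFact a n = ∏ j ∈ Finset.range n, (a + j) := by
  induction n with
  | zero => simp [shiftedFact]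
  | succ n ih => rw [shiftedFact, ih, Finset.prod_range_succ]

lemma cf_zero (a : ℝ) : cf a 0 = 1 := by simp [cf, shiftedFact]

lemma cf_succ (a : ℝ) (n : ℕ) :
    (n + 1) * cf a (n + 1) = n * cf a n + a * (1 - a) * (cf a n / (n + 1)) := by
  have h : ((n.factorial : ℝ)) ≠ 0 := by positivity
  have h' : (n : ℝ) + 1 ≠ 0 := by positivity
  simp only [cf, sf_one, shiftedFact, Nat.factorial_succ]
  push_cast
  field_simp
  ring

lemma cf_pos (a : ℝ) (h0 : 0 < a) (h1 : a < 1) (n : ℕ) : 0 < cf a n := by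
  have := sf_pos a h0 n
  have := sf_pos (1 - a) (by linarith) n
  rw [cf, sf_one]
  positivity

lemma cf_le (a : ℝ) (h0 : 0 < a) (h1 : a < 1) (n : ℕ) : cf a n ≤ 1 := by
  induction n with
  | zero => rw [cf_zero]
  | succ n ih =>
    have h := cf_succ a n
    have hp := cf_pos a h0 h1 n
    have hp1 := cf_pos a h0 h1 (n + 1)
    have h2 : a * (1 - a) ≤ 1 := by nlinarith
    have h3 : cf a n / (n + 1) ≤ 1 := by
      rw [div_le_one (by positivity)]
      have : (0:ℝ) ≤ n := Nat.cast_nonneg n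
      linarith
    have h4 : 0 < cf a n / (n + 1) := by positivity
    have hn : (0:ℝ) ≤ n := Nat.cast_nonneg n
    have h5 : a * (1 - a) * (cf a n / (n + 1)) ≤ 1 := by
      have : 0 < a * (1 - a) := mul_pos h0 (by linarith)
      nlinarith
    by_contra! hcon
    nlinarith

lemma cf_abs (a : ℝ) (h0 : 0 < a) (h1 : a < 1) (n : ℕ) : |cf a n| ≤ 1 := by
  rw [abs_of_pos (cf_pos a h0 h1 n)]; exact cf_le a h0 h1 n

lemma cf_abs' (a : ℝ) (h0 : 0 < a) (h1 : a < 1) (n : ℕ) : |cf a n / (n + 1)| ≤ 1 := by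
  have := cf_pos a h0 h1 n
  rw [abs_of_pos (by positivity), div_le_one (by positivity)]
  have := cf_le a h0 h1 n
  have hn : (0:ℝ) ≤ n := Nat.cast_nonneg n
  linarith

lemma mul_ser1 (c : ℕ → ℝ) (x : ℝ) :
    x * (∑' n : ℕ, n * c n * x ^ (n - 1)) = ∑' n : ℕ, n * c n * x ^ n := by
  rw [← tsum_mul_left]
  refine tsum_congr fun n => ?_
  rcases n with _ | n
  · simp
  · simp only [Nat.add_sub_cancel]; ring

lemma summable_nc (c : ℕ → ℝ) (hc : ∀ n, |c n| ≤ 1) (x : ℝ) (hx : |x| < 1) :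
    Summable (fun n : ℕ => n * c n * x ^ n) := by
  refine ((ser_summable1 c hc x hx).mul_left x).congr fun n => ?_
  rcases n with _ | n
  · simp
  · simp only [Nat.add_sub_cancel]; ring

lemma cF_deriv (a : ℝ) (h0 : 0 < a) (h1 : a < 1) (x : ℝ) (hx : |x| < 1) :
    HasDerivAt (cF a) (a * (1 - a) * cH a x / (1 - x)) x := by
  have hd := ser_deriv (cf a) (cf_abs a h0 h1) x hx
  convert! hd using 1
  have hx1 : 1 - x ≠ 0 := by have := (abs_lt.1 hx).2; linarith
  have hm : ∀ S : ℝ, S * (1 - x) = S - x * S := fun S => by ring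
  rw [div_eq_iff hx1, hm, mul_ser1]
  have hs := ser_summable1 (cf a) (cf_abs a h0 h1) x hx
  rw [hs.tsum_eq_zero_add]
  have hs1 := (summable_nat_add_iff 1).2 hs
  simp only [Nat.cast_zero, zero_mul, zero_add]
  rw [← hs1.tsum_sub (summable_nc (cf a) (cf_abs a h0 h1) x hx), cH, ← tsum_mul_left]
  refine tsum_congr fun n => ?_
  have := cf_succ a n
  simp only [Nat.add_sub_cancel]
  push_cast
  rw [this]; ring

lemma cH_deriv (a : ℝ) (h0 : 0 < a) (h1 : a < 1) (x : ℝ) (hx : |x| < 1) :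
    HasDerivAt (cH a) (cH1 a x) x :=
  ser_deriv (fun n => cf a n / (n + 1)) (cf_abs' a h0 h1) x hx

lemma cH_eq (a : ℝ) (h0 : 0 < a) (h1 : a < 1) (x : ℝ) (hx : |x| < 1) :
    cH a x + x * cH1 a x = cF a x := by
  rw [cH1, mul_ser1 (fun n => cf a n / (n + 1)), cH, cF,
    ← (ser_summable _ (cf_abs' a h0 h1) x hx).tsum_add (summable_nc (fun n => cf a n / (n + 1)) (cf_abs' a h0 h1) x hx)]
  refine tsum_congr fun n => ?_
  have h' : (n : ℝ) + 1 ≠ 0 := by positivity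
  field_simp
  ring

lemma cH1_nonneg (a : ℝ) (h0 : 0 < a) (h1 : a < 1) (x : ℝ) (hx : 0 ≤ x) : 0 ≤ cH1 a x := by
  refine tsum_nonneg fun n => ?_
  have := cf_pos a h0 h1 n
  positivity

lemma cF_zero (a : ℝ) : cF a 0 = 1 := by
  rw [cF, tsum_eq_single 0]
  · simp [cf_zero]
  · intro n hn; simp [hn]

lemma cH_zero (a : ℝ) : cH a 0 = 1 := by
  rw [cH, tsum_eq_single 0]
  · simp [cf_zero]
  · intro n hn; simp [hn]

lemma cH_ge (a : ℝ) (h0 : 0 < a) (h1 : a < 1) (x : ℝ) (hx0 : 0 ≤ x) (hx : x < 1) : 1 ≤ cH a x := by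
  have hs := ser_summable _ (cf_abs' a h0 h1) x (by rwa [abs_of_nonneg hx0])
  have := hs.le_tsum 0 (fun n _ => by have := cf_pos a h0 h1 n; positivity)
  simpa [cf_zero, cH] using this

lemma partial_sum (a : ℝ) (N : ℕ) :
    ∑ n ∈ Finset.range N, (a * (1 - a) * (cf a n / (n + 1))) = N * cf a N := by
  induction N with
  | zero => simp
  | succ N ih => rw [Finset.sum_range_succ, ih]; push_cast; rw [cf_succ]

lemma gam (a : ℝ) (h0 : 0 < a) (h1 : a < 1) :
    Tendsto (fun N : ℕ => N * cf a N) atTop (𝓝 (Real.sin (π * a) / π)) := by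
  have hs : 0 < Real.sin (π * a) := Real.sin_pos_of_pos_of_lt_pi (by positivity) (by nlinarith [Real.pi_pos])
  have h := (Real.GammaSeq_tendsto_Gamma a).mul (Real.GammaSeq_tendsto_Gamma (1 - a))
  rw [Real.Gamma_mul_Gamma_one_sub] at h
  have h2 := h.inv₀ (by positivity)
  rw [inv_div] at h2
  have hl : Tendsto (fun N : ℕ => ((N:ℝ) / (a + N)) * ((N:ℝ) / ((1 - a) + N))) atTop (𝓝 (1 * 1)) := by
    have : ∀ b : ℝ, Tendsto (fun N : ℕ => ((N:ℝ) / (b + N))) atTop (𝓝 1) := by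
      intro b
      have := tendsto_natCast_div_add_atTop (𝕜 := ℝ) b
      simpa [add_comm] using this
    exact (this a).mul (this (1 - a))
  have h3 := hl.mul h2
  rw [one_mul, one_mul] at h3
  refine h3.congr' ?_
  filter_upwards [eventually_gt_atTop 0] with N hN
  have hN' : (0:ℝ) < N := by exact_mod_cast hN
  have e : (N:ℝ) ^ a * (N:ℝ) ^ (1 - a) = N := by
    rw [← Real.rpow_add hN']; simp
  have p1 := sf_pos a h0 N
  have p2 := sf_pos (1 - a) (by linarith) N
  have p3 : 0 < (N:ℝ) ^ a := by positivity
  have p4 : 0 < (N:ℝ) ^ (1 - a) := by positivity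
  have p5 : 0 < a + N := by positivity
  have p6 : 0 < 1 - a + N := by linarith
  simp only [Real.GammaSeq]
  rw [← sf_prod, ← sf_prod, cf, sf_one]
  simp only [shiftedFact]
  have e' : ((N:ℝ) ^ a * N.factorial / (shiftedFact a N * (a + N)) *
     ((N:ℝ) ^ (1 - a) * N.factorial / (shiftedFact (1 - a) N * (1 - a + N))))
     = ((N:ℝ) ^ a * (N:ℝ) ^ (1 - a)) * (N.factorial * N.factorial) / ((shiftedFact a N * (a + N)) * (shiftedFact (1 - a) N * (1 - a + N))) := by
    field_simp
  rw [e', e]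
  have : (0:ℝ) < N.factorial := by positivity
  field_simp

lemma cH_lim (a : ℝ) (h0 : 0 < a) (h1 : a < 1) :
    Tendsto (fun x => a * (1 - a) * cH a x) (𝓝[<] 1) (𝓝 (Real.sin (π * a) / π)) := by
  have h := gam a h0 h1
  simp_rw [← partial_sum] at h
  have h2 := Real.tendsto_tsum_powerSeries_nhdsWithin_lt h
  refine h2.congr fun x => ?_
  rw [cH, ← tsum_mul_left]
  refine tsum_congr fun n => ?_
  ring

structure Dat (F H H1 : ℝ → ℝ) (α w : ℝ) : Prop where
  apos : 0 < α
  ale : α ≤ 1 / 4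
  wpos : 0 < w
  dF : ∀ x, |x| < 1 → HasDerivAt F (α * H x / (1 - x)) x
  dH : ∀ x, |x| < 1 → HasDerivAt H (H1 x) x
  eq : ∀ x, |x| < 1 → H x + x * H1 x = F x
  H1n : ∀ x, 0 ≤ x → 0 ≤ H1 x
  Hge : ∀ x, 0 ≤ x → x < 1 → 1 ≤ H x
  F0 : F 0 = 1
  H0 : H 0 = 1
  lim : Tendsto (fun x => α * H x) (𝓝[<] 1) (𝓝 w)

lemma mkDat (a : ℝ) (h0 : 0 < a) (h1 : a < 1) :
    Dat (cF a) (cH a) (cH1 a) (a * (1 - a)) (Real.sin (π * a) / π) where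
  apos := mul_pos h0 (by linarith)
  ale := by nlinarith [sq_nonneg (a - 1 / 2)]
  wpos := div_pos (Real.sin_pos_of_pos_of_lt_pi (by positivity) (by nlinarith [Real.pi_pos])) Real.pi_pos
  dF := cF_deriv a h0 h1
  dH := cH_deriv a h0 h1
  eq := cH_eq a h0 h1
  H1n := cH1_nonneg a h0 h1
  Hge := cH_ge a h0 h1
  F0 := cF_zero a
  H0 := cH_zero a
  lim := cH_lim a h0 h1

lemma abs_of_Ico {x : ℝ} (h0 : 0 ≤ x) (h1 : x < 1) : |x| < 1 := by rwa [abs_of_nonneg h0]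

namespace Dat
variable {F H H1 : ℝ → ℝ} {α w : ℝ}

lemma HleF (D : Dat F H H1 α w) (x : ℝ) (h0 : 0 ≤ x) (h1 : x < 1) : H x ≤ F x := by
  have := D.eq x (abs_of_Ico h0 h1)
  nlinarith [mul_nonneg h0 (D.H1n x h0)]

lemma Fpos (D : Dat F H H1 α w) (x : ℝ) (h0 : 0 ≤ x) (h1 : x < 1) : 0 < F x := by
  linarith [D.HleF x h0 h1, D.Hge x h0 h1]

lemma Fcont (D : Dat F H H1 α w) : ContinuousOn F (Ico 0 1) := fun x hx =>
  (D.dF x (abs_of_Ico hx.1 hx.2)).continuousAt.continuousWithinAt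

lemma Fmono (D : Dat F H H1 α w) : StrictMonoOn F (Ico 0 1) := by
  refine strictMonoOn_of_deriv_pos (convex_Ico 0 1) D.Fcont ?_
  intro x hx
  rw [interior_Ico] at hx
  rw [(D.dF x (abs_of_Ico hx.1.le hx.2)).deriv]
  have := D.Hge x hx.1.le hx.2
  have := D.apos
  have : 0 < 1 - x := by linarith [hx.2]
  positivity

lemma dG (D : Dat F H H1 α w) (x : ℝ) (h0 : 0 < x) (h1 : x < 1) :
    HasDerivAt (fun x => F (1 - x)) (-(α * H (1 - x) / x)) x := by
  have h := (D.dF (1 - x) (abs_of_Ico (by linarith) (by linarith))).comp x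
    ((hasDerivAt_id x).const_sub 1)
  convert! h using 1
  simp

lemma dHG (D : Dat F H H1 α w) (x : ℝ) (h0 : 0 < x) (h1 : x < 1) :
    HasDerivAt (fun x => H (1 - x)) (-(H1 (1 - x))) x := by
  have h := (D.dH (1 - x) (abs_of_Ico (by linarith) (by linarith))).comp x
    ((hasDerivAt_id x).const_sub 1)
  convert! h using 1
  simp

/-- `(1-x) F^2` is antitone. -/
lemma sqAnti (D : Dat F H H1 α w) : StrictAntiOn (fun x => (1 - x) * F x ^ 2) (Ico 0 1) := by
  have hd : ∀ x ∈ Ico (0:ℝ) 1, HasDerivAt (fun x => (1 - x) * F x ^ 2)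
      (-1 * F x ^ 2 + (1 - x) * (2 * F x * (α * H x / (1 - x)))) x := by
    intro x hx
    have h1 := (hasDerivAt_id x).const_sub 1
    have h2 := (D.dF x (abs_of_Ico hx.1 hx.2)).pow 2
    convert! h1.mul h2 using 1
    simp
  refine strictAntiOn_of_deriv_neg (convex_Ico 0 1)
    (fun x hx => (hd x hx).continuousAt.continuousWithinAt) ?_
  · intro x hx
    have hx := interior_subset hx
    rw [(hd x hx).deriv]
    have h1 : 0 < 1 - x := by linarith [hx.2]
    have e : (1 - x) * (2 * F x * (α * H x / (1 - x))) = 2 * F x * (α * H x) := by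
      field_simp
    rw [e]
    have a1 := D.HleF x hx.1 hx.2
    have a2 := D.Fpos x hx.1 hx.2
    have a3 := D.Hge x hx.1 hx.2
    have : α * H x ≤ 1 / 4 * F x := by nlinarith [D.apos, D.ale]
    nlinarith

lemma sqle (D : Dat F H H1 α w) (x : ℝ) (h0 : 0 ≤ x) (h1 : x < 1) : (1 - x) * F x ^ 2 ≤ 1 := by
  have := D.sqAnti.antitoneOn (left_mem_Ico.2 one_pos) ⟨h0, h1⟩ h0
  simpa [D.F0] using this

lemma limF (D : Dat F H H1 α w) : Tendsto (fun x => (1 - x) * F x) (𝓝[<] 1) (𝓝 0) := by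
  have hs : Tendsto (fun x : ℝ => √(1 - x)) (𝓝[<] 1) (𝓝 0) := by
    have : Continuous (fun x : ℝ => √(1 - x)) := by fun_prop
    have h := this.tendsto 1
    simp only [sub_self, Real.sqrt_zero] at h
    exact h.mono_left nhdsWithin_le_nhds
  have hm : Ioo (0:ℝ) 1 ∈ 𝓝[<] (1:ℝ) := Ioo_mem_nhdsLT one_pos
  refine squeeze_zero' ?_ ?_ hs
  · filter_upwards [hm] with x hx
    exact mul_nonneg (by linarith [hx.2]) (D.Fpos x hx.1.le hx.2).le
  · filter_upwards [hm] with x hx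
    apply Real.le_sqrt_of_sq_le
    have := D.sqle x hx.1.le hx.2
    have h1 : 0 < 1 - x := by linarith [hx.2]
    nlinarith

lemma wron (D : Dat F H H1 α w) (x : ℝ) (h0 : 0 < x) (h1 : x < 1) :
    α * (x * H x) * F (1 - x) + F x * (α * ((1 - x) * H (1 - x))) = w := by
  set W : ℝ → ℝ := fun x => α * (x * H x) * F (1 - x) + F x * (α * ((1 - x) * H (1 - x))) with hW
  have hd : ∀ x ∈ Ioo (0:ℝ) 1, HasDerivAt W 0 x := by
    intro x hx
    have hab := abs_of_Ico hx.1.le hx.2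
    have hab' : |1 - x| < 1 := abs_of_Ico (by linarith [hx.2]) (by linarith [hx.1])
    have e1 := D.eq x hab
    have e2 := D.eq (1 - x) hab'
    have p1 := (((hasDerivAt_id x).mul (D.dH x hab)).const_mul α).mul (D.dG x hx.1 hx.2)
    have p2 := (D.dF x hab).mul
      (((((hasDerivAt_id x).const_sub 1)).mul (D.dHG x hx.1 hx.2)).const_mul α)
    have p3 := p1.add p2
    convert! p3 using 1
    have hx0 : x ≠ 0 := hx.1.ne'
    have hx1 : 1 - x ≠ 0 := by linarith [hx.2]
    simp only [id, Pi.mul_apply, ← e1, ← e2]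
    field_simp
    ring
  have hc : ∀ y ∈ Ioo (0:ℝ) 1, W y = W x := by
    intro y hy
    exact isOpen_Ioo.is_const_of_deriv_eq_zero isPreconnected_Ioo
      (fun z hz => (hd z hz).differentiableAt.differentiableWithinAt)
      (fun z hz => (hd z hz).deriv) hy ⟨h0, h1⟩
  have hm : Ioo (0:ℝ) 1 ∈ 𝓝[<] (1:ℝ) := Ioo_mem_nhdsLT one_pos
  have l1 : Tendsto W (𝓝[<] 1) (𝓝 (W x)) := by
    refine tendsto_const_nhds.congr' ?_
    filter_upwards [hm] with y hy
    exact (hc y hy).symm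
  have ls : Tendsto (fun x : ℝ => 1 - x) (𝓝[<] 1) (𝓝 0) := by
    have : Continuous (fun x : ℝ => 1 - x) := by fun_prop
    have h := this.tendsto 1
    simp only [sub_self] at h
    exact h.mono_left nhdsWithin_le_nhds
  have lF : Tendsto (fun x => F (1 - x)) (𝓝[<] 1) (𝓝 1) := by
    have := (D.dF 0 (by simp)).continuousAt.tendsto
    rw [D.F0] at this
    exact this.comp ls
  have lH : Tendsto (fun x => H (1 - x)) (𝓝[<] 1) (𝓝 1) := by
    have := (D.dH 0 (by simp)).continuousAt.tendsto
    rw [D.H0] at this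
    exact this.comp ls
  have lx : Tendsto (fun x : ℝ => x) (𝓝[<] 1) (𝓝 1) := tendsto_id.mono_left nhdsWithin_le_nhds
  have l2 := ((lx.mul D.lim).mul lF).add ((D.limF.mul lH).const_mul α)
  have l3 : Tendsto W (𝓝[<] 1) (𝓝 (1 * w * 1 + α * (0 * 1))) := by
    refine l2.congr fun y => ?_
    simp only [hW]; ring
  have := tendsto_nhds_unique l1 l3
  simpa using this

lemma Fbig (D : Dat F H H1 α w) (M : ℝ) : ∃ x ∈ Ioo (1/2 : ℝ) 1, ∀ y ∈ Ico x 1, M < F y := by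
  have hd : ∀ x ∈ Ico (0:ℝ) 1, HasDerivAt (fun x => F x + α * Real.log (1 - x))
      (α * H x / (1 - x) + α * (-1 / (1 - x))) x := by
    intro x hx
    have h1 : (1 - x) ≠ 0 := by linarith [hx.2]
    exact (D.dF x (abs_of_Ico hx.1 hx.2)).add ((((hasDerivAt_id x).const_sub 1).log h1).const_mul α)
  have hm : MonotoneOn (fun x => F x + α * Real.log (1 - x)) (Ico 0 1) := by
    refine monotoneOn_of_deriv_nonneg (convex_Ico 0 1)
      (fun x hx => (hd x hx).continuousAt.continuousWithinAt) ?_ ?_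
    · intro x hx
      exact (hd x (interior_subset hx)).differentiableAt.differentiableWithinAt
    · intro x hx
      have hx := interior_subset hx
      rw [(hd x hx).deriv]
      have h1 : 0 < 1 - x := by linarith [hx.2]
      have : α * H x / (1 - x) + α * (-1 / (1 - x)) = α * (H x - 1) / (1 - x) := by
        field_simp; ring
      rw [this]
      have := D.Hge x hx.1 hx.2
      exact div_nonneg (mul_nonneg D.apos.le (by linarith)) h1.le
  have key : ∀ y ∈ Ico (0:ℝ) 1, 1 - α * Real.log (1 - y) ≤ F y := by
    intro y hy
    have := hm (left_mem_Ico.2 one_pos) hy hy.1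
    simp [D.F0] at this
    linarith
  set m := max M 1 with hmdef
  have hm1 : 1 ≤ m := le_max_right _ _
  have hMm : M ≤ m := le_max_left _ _
  refine ⟨1 - Real.exp (-(m / α)), ⟨?_, ?_⟩, ?_⟩
  · have : Real.exp (-(m / α)) < 1/2 := by
      rw [Real.exp_neg]
      have h4 : 4 ≤ m / α := by
        rw [le_div_iff₀ D.apos]; linarith [D.ale]
      have := Real.add_one_le_exp (m / α)
      rw [inv_lt_comm₀ (Real.exp_pos _) (by norm_num)]
      norm_num; linarith
    linarith
  · linarith [Real.exp_pos (-(m / α))]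
  · intro y hy
    have hy0 : 0 ≤ y := by
      have : Real.exp (-(m / α)) ≤ 1 := by
        rw [Real.exp_le_one_iff]
        have := D.apos
        have : 0 ≤ m / α := by positivity
        linarith
      linarith [hy.1]
    have h1 := key y ⟨hy0, hy.2⟩
    have h2 : Real.log (1 - y) ≤ -(m / α) := by
      rw [Real.log_le_iff_le_exp (by linarith [hy.2])]
      linarith [hy.1]
    have h3 : α * Real.log (1 - y) ≤ α * (-(m / α)) := mul_le_mul_of_nonneg_left h2 D.apos.le
    have h4 : α * (-(m / α)) = -m := by have := D.apos; field_simp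
    linarith

/-- `F'/(α F^3)` is strictly increasing. -/
lemma qmono (D : Dat F H H1 α w) : StrictMonoOn (fun x => H x / ((1 - x) * F x ^ 3)) (Ioo 0 1) := by
  have hd : ∀ x ∈ Ioo (0:ℝ) 1, HasDerivAt (fun x => H x / ((1 - x) * F x ^ 3))
      ((H1 x * ((1 - x) * F x ^ 3) - H x * (-1 * F x ^ 3 + (1 - x) * (3 * F x ^ 2 * (α * H x / (1 - x)))))
        / ((1 - x) * F x ^ 3) ^ 2) x := by
    intro x hx
    have hab := abs_of_Ico hx.1.le hx.2
    have h1 : (1 - x) ≠ 0 := by linarith [hx.2]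
    have h2 := (D.Fpos x hx.1.le hx.2).ne'
    have := (D.dH x hab).div (((hasDerivAt_id x).const_sub 1).mul ((D.dF x hab).pow 3))
      (by simp [h1, h2])
    convert! this using 1
  refine strictMonoOn_of_deriv_pos (convex_Ioo 0 1)
    (fun x hx => (hd x hx).continuousAt.continuousWithinAt) ?_
  intro x hx
  rw [interior_Ioo] at hx
  rw [(hd x hx).deriv]
  have h1 : 0 < 1 - x := by linarith [hx.2]
  have a1 := D.HleF x hx.1.le hx.2
  have a2 := D.Fpos x hx.1.le hx.2
  have a3 := D.Hge x hx.1.le hx.2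
  have a4 := D.H1n x hx.1.le
  have e : (H1 x * ((1 - x) * F x ^ 3) - H x * (-1 * F x ^ 3 + (1 - x) * (3 * F x ^ 2 * (α * H x / (1 - x)))))
    = F x ^ 2 * (H1 x * (1 - x) * F x + H x * (F x - 3 * (α * H x))) := by
    field_simp; ring
  rw [e]
  have : α * H x ≤ 1 / 4 * F x := by nlinarith [D.apos, D.ale]
  have b1 : 0 < H x * (F x - 3 * (α * H x)) := mul_pos (by linarith) (by linarith)
  have b2 : 0 ≤ H1 x * (1 - x) * F x := by positivity
  have : 0 < H1 x * (1 - x) * F x + H x * (F x - 3 * (α * H x)) := by linarith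
  positivity

end Dat

lemma lhop_lt {f g f' g' ρ : ℝ → ℝ} {b x : ℝ} (hbx : b < x)
    (hf : ∀ y ∈ Icc b x, HasDerivAt f (f' y) y) (hg : ∀ y ∈ Icc b x, HasDerivAt g (g' y) y)
    (hg' : ∀ y ∈ Icc b x, 0 < g' y) (hr : ∀ y ∈ Icc b x, f' y = ρ y * g' y)
    (hρ : StrictMonoOn ρ (Icc b x)) :
    ρ b * (g x - g b) < f x - f b ∧ f x - f b < ρ x * (g x - g b) := by
  have gc : ContinuousOn g (Icc b x) := fun y hy => (hg y hy).continuousAt.continuousWithinAt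
  have fc : ContinuousOn f (Icc b x) := fun y hy => (hf y hy).continuousAt.continuousWithinAt
  obtain ⟨c, hc, h⟩ := exists_ratio_hasDerivAt_eq_ratio_slope f f' hbx fc
    (fun y hy => hf y (Ioo_subset_Icc_self hy)) g g' gc (fun y hy => hg y (Ioo_subset_Icc_self hy))
  have gm : StrictMonoOn g (Icc b x) := by
    refine strictMonoOn_of_deriv_pos (convex_Icc b x) gc ?_
    intro y hy
    have hy := interior_subset hy
    rw [(hg y hy).deriv]; exact hg' y hy
  have hgl := gm (left_mem_Icc.2 hbx.le) (right_mem_Icc.2 hbx.le) hbx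
  have hcI := Ioo_subset_Icc_self hc
  have hgc := hg' c hcI
  have e : f x - f b = ρ c * (g x - g b) := by
    rw [hr c hcI] at h
    have : (ρ c * (g x - g b)) * g' c = (f x - f b) * g' c := by rw [← h]; ring
    exact (mul_right_cancel₀ hgc.ne' this).symm
  rw [e]
  have r1 := hρ (left_mem_Icc.2 hbx.le) hcI hc.1
  have r2 := hρ hcI (right_mem_Icc.2 hbx.le) hc.2
  constructor <;> apply mul_lt_mul_of_pos_right _ (by linarith) <;> assumption

lemma lhop_mono {f g f' g' ρ : ℝ → ℝ} {b e : ℝ} (hfb : f b = 0) (hgb : g b = 0)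
    (hf : ∀ y ∈ Ico b e, HasDerivAt f (f' y) y) (hg : ∀ y ∈ Ico b e, HasDerivAt g (g' y) y)
    (hg' : ∀ y ∈ Ico b e, 0 < g' y) (hr : ∀ y ∈ Ico b e, f' y = ρ y * g' y)
    (hρ : StrictMonoOn ρ (Ico b e)) :
    StrictMonoOn (fun x => f x / g x) (Ioo b e) := by
  have key : ∀ {u x : ℝ}, b ≤ u → u < x → x < e →
      ρ u * (g x - g u) < f x - f u ∧ f x - f u < ρ x * (g x - g u) := by
    intro u x hu hux hx
    have hs : Icc u x ⊆ Ico b e := fun y hy => ⟨hu.trans hy.1, hy.2.trans_lt hx⟩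
    exact lhop_lt hux (fun y hy => hf y (hs hy)) (fun y hy => hg y (hs hy)) (fun y hy => hg' y (hs hy))
      (fun y hy => hr y (hs hy)) (hρ.mono hs)
  have gc : ContinuousOn g (Ico b e) := fun y hy => (hg y hy).continuousAt.continuousWithinAt
  have gm : StrictMonoOn g (Ico b e) := by
    refine strictMonoOn_of_deriv_pos (convex_Ico b e) gc ?_
    intro y hy
    have hy := interior_subset hy
    rw [(hg y hy).deriv]; exact hg' y hy
  intro x hx y hy hxy
  have k1 := key le_rfl hx.1 hx.2
  have k2 := key hx.1.le hxy hy.2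
  have g1 := gm ⟨le_rfl, hx.1.trans hx.2⟩ ⟨hx.1.le, hx.2⟩ hx.1
  have g2 := gm ⟨hx.1.le, hx.2⟩ ⟨hy.1.le, hy.2⟩ hxy
  simp only [hfb, hgb, sub_zero] at k1 g1
  show f x / g x < f y / g y
  rw [div_lt_div_iff₀ g1 (g1.trans g2)]
  nlinarith [mul_lt_mul_of_pos_right k1.2 (sub_pos.2 g2), mul_lt_mul_of_pos_right k2.1 g1]

lemma lhop_image {f g f' g' ρ : ℝ → ℝ} {b e l : ℝ} (hbe : b < e) (hfb : f b = 0) (hgb : g b = 0)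
    (hf : ∀ y ∈ Ico b e, HasDerivAt f (f' y) y) (hg : ∀ y ∈ Ico b e, HasDerivAt g (g' y) y)
    (hg' : ∀ y ∈ Ico b e, 0 < g' y) (hr : ∀ y ∈ Ico b e, f' y = ρ y * g' y)
    (hρ : StrictMonoOn ρ (Ico b e)) (hρc : ContinuousAt ρ b) (hρl : Tendsto ρ (𝓝[<] e) (𝓝 l))
    (hgl : Tendsto g (𝓝[<] e) atTop) :
    (fun x => f x / g x) '' (Ioo b e) = Ioo (ρ b) l := by
  have key : ∀ {u x : ℝ}, b ≤ u → u < x → x < e →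
      ρ u * (g x - g u) < f x - f u ∧ f x - f u < ρ x * (g x - g u) := by
    intro u x hu hux hx
    have hs : Icc u x ⊆ Ico b e := fun y hy => ⟨hu.trans hy.1, hy.2.trans_lt hx⟩
    exact lhop_lt hux (fun y hy => hf y (hs hy)) (fun y hy => hg y (hs hy)) (fun y hy => hg' y (hs hy))
      (fun y hy => hr y (hs hy)) (hρ.mono hs)
  have gc : ContinuousOn g (Ico b e) := fun y hy => (hg y hy).continuousAt.continuousWithinAt
  have fc : ContinuousOn f (Ico b e) := fun y hy => (hf y hy).continuousAt.continuousWithinAt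
  have gm : StrictMonoOn g (Ico b e) := by
    refine strictMonoOn_of_deriv_pos (convex_Ico b e) gc ?_
    intro y hy
    have hy := interior_subset hy
    rw [(hg y hy).deriv]; exact hg' y hy
  have gpos : ∀ x ∈ Ioo b e, 0 < g x := by
    intro x hx
    have := gm ⟨le_rfl, hbe⟩ ⟨hx.1.le, hx.2⟩ hx.1
    rwa [hgb] at this
  have b1 : ∀ x ∈ Ioo b e, ρ b < f x / g x ∧ f x / g x < ρ x := by
    intro x hx
    have := key le_rfl hx.1 hx.2
    simp only [hfb, hgb, sub_zero] at this
    exact ⟨(lt_div_iff₀ (gpos x hx)).2 this.1, (div_lt_iff₀ (gpos x hx)).2 this.2⟩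
  have hm : ∀ x, x < e → Ioo x e ∈ 𝓝[<] e := fun x hx => Ioo_mem_nhdsLT hx
  have ρle : ∀ x ∈ Ico b e, ρ x ≤ l := by
    intro x hx
    refine ge_of_tendsto hρl ?_
    filter_upwards [hm x hx.2] with y hy
    exact (hρ hx ⟨hx.1.trans hy.1.le, hy.2⟩ hy.1).le
  apply Subset.antisymm
  · rintro _ ⟨x, hx, rfl⟩
    exact ⟨(b1 x hx).1, (b1 x hx).2.trans_le (ρle x ⟨hx.1.le, hx.2⟩)⟩
  · intro y hy
    obtain ⟨x1, hx1, hy1⟩ : ∃ x1 ∈ Ioo b e, f x1 / g x1 < y := by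
      have h1 : ∀ᶠ x in 𝓝[>] b, ρ x < y := (hρc.tendsto.mono_left nhdsWithin_le_nhds).eventually (gt_mem_nhds hy.1)
      have h2 : Ioo b e ∈ 𝓝[>] b := Ioo_mem_nhdsGT hbe
      obtain ⟨x, hx, hx'⟩ := (h1.and h2).exists
      exact ⟨x, hx', (b1 x hx').2.trans hx⟩
    obtain ⟨x2, hx2, hy2⟩ : ∃ x2 ∈ Ioo b e, y < f x2 / g x2 := by
      obtain ⟨x0, hx0, hx0'⟩ := ((hρl.eventually (lt_mem_nhds hy.2)).and (hm b hbe)).exists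
      obtain ⟨x, ⟨hxa, hxb⟩⟩ := ((hgl.eventually_gt_atTop ((ρ x0 * g x0 - f x0) / (ρ x0 - y))).and (hm x0 hx0'.2)).exists
      have hxI : x ∈ Ioo b e := ⟨hx0'.1.trans hxb.1, hxb.2⟩
      refine ⟨x, hxI, ?_⟩
      rw [lt_div_iff₀ (gpos x hxI)]
      have := (key hx0'.1.le hxb.1 hxb.2).1
      rw [div_lt_iff₀ (by linarith)] at hxa
      nlinarith
    have hc : ContinuousOn (fun x => f x / g x) (Ioo b e) :=
      (fc.mono Ioo_subset_Ico_self).div (gc.mono Ioo_subset_Ico_self) fun x hx => (gpos x hx).ne'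
    exact isPreconnected_Ioo.intermediate_value hx1 hx2 hc ⟨hy1.le, hy2.le⟩

lemma conv_param {L k k' f f' ρ : ℝ → ℝ}
    (hk : ∀ x ∈ Ioo (0:ℝ) 1, HasDerivAt k (k' x) x) (hk' : ∀ x ∈ Ioo (0:ℝ) 1, 0 < k' x)
    (hs : ∀ K, 0 < K → ∃ x ∈ Ioo (0:ℝ) 1, k x = K)
    (hL : ∀ x ∈ Ioo (0:ℝ) 1, L (k x) = f x)
    (hf : ∀ x ∈ Ioo (0:ℝ) 1, HasDerivAt f (f' x) x)
    (hr : ∀ y ∈ Ioo (0:ℝ) 1, f' y = ρ y * k' y)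
    (hρ : StrictMonoOn ρ (Ioo 0 1)) : ConvexOn ℝ (Ioi 0) L := by
  have kc : ContinuousOn k (Ioo 0 1) := fun y hy => (hk y hy).continuousAt.continuousWithinAt
  have km : StrictMonoOn k (Ioo 0 1) := by
    refine strictMonoOn_of_deriv_pos (convex_Ioo 0 1) kc ?_
    intro y hy
    have hy := interior_subset hy
    rw [(hk y hy).deriv]; exact hk' y hy
  refine convexOn_of_slope_mono_adjacent (convex_Ioi 0) ?_
  intro x y z hx hz hxy hyz
  obtain ⟨u, hu, rfl⟩ := hs x hx
  obtain ⟨v, hv, rfl⟩ := hs y (lt_trans hx hxy)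
  obtain ⟨t, ht, rfl⟩ := hs z hz
  have huv := (km.lt_iff_lt hu hv).1 hxy
  have hvt := (km.lt_iff_lt hv ht).1 hyz
  have key : ∀ {u x : ℝ}, u ∈ Ioo (0:ℝ) 1 → u < x → x ∈ Ioo (0:ℝ) 1 →
      ρ u * (k x - k u) < f x - f u ∧ f x - f u < ρ x * (k x - k u) := by
    intro u x hu hux hx
    have hs : Icc u x ⊆ Ioo 0 1 := fun y hy => ⟨hu.1.trans_le hy.1, hy.2.trans_lt hx.2⟩
    exact lhop_lt hux (fun y hy => hf y (hs hy)) (fun y hy => hk y (hs hy)) (fun y hy => hk' y (hs hy))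
      (fun y hy => hr y (hs hy)) (hρ.mono hs)
  rw [hL u hu, hL v hv, hL t ht]
  have h1 := (key hu huv hv).2
  have h2 := (key hv hvt ht).1
  have h3 : (f v - f u) / (k v - k u) ≤ ρ v := by
    rw [div_le_iff₀ (by linarith)]; exact h1.le
  have h4 : ρ v ≤ (f t - f v) / (k t - k v) := by
    rw [le_div_iff₀ (by linarith)]; exact h2.le
  exact h3.trans h4

noncomputable def kk (F : ℝ → ℝ) (x : ℝ) : ℝ := F x / F (1 - x)

namespace Dat
variable {F H H1 : ℝ → ℝ} {α w : ℝ}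

lemma dk (D : Dat F H H1 α w) (x : ℝ) (hx : x ∈ Ioo (0:ℝ) 1) :
    HasDerivAt (kk F) (w / (x * (1 - x) * F (1 - x) ^ 2)) x := by
  have h0 := hx.1.ne'
  have h1 : 1 - x ≠ 0 := by linarith [hx.2]
  have p := (D.Fpos (1 - x) (by linarith [hx.2]) (by linarith [hx.1])).ne'
  have := (D.dF x (abs_of_Ico hx.1.le hx.2)).div (D.dG x hx.1 hx.2) p
  convert! this using 1
  rw [← D.wron x hx.1 hx.2]
  field_simp
  ring

lemma dkpos (D : Dat F H H1 α w) (x : ℝ) (hx : x ∈ Ioo (0:ℝ) 1) :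
    0 < w / (x * (1 - x) * F (1 - x) ^ 2) := by
  have h0 := hx.1
  have h1 : 0 < 1 - x := by linarith [hx.2]
  have p := (D.Fpos (1 - x) (by linarith [hx.2]) (by linarith [hx.1]))
  have := D.wpos
  positivity

lemma kcont (D : Dat F H H1 α w) : ContinuousOn (kk F) (Ioo 0 1) :=
  fun x hx => (D.dk x hx).continuousAt.continuousWithinAt

lemma kmono (D : Dat F H H1 α w) : StrictMonoOn (kk F) (Ioo 0 1) := by
  refine strictMonoOn_of_deriv_pos (convex_Ioo 0 1) D.kcont ?_
  intro y hy
  have hy := interior_subset hy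
  rw [(D.dk y hy).deriv]; exact D.dkpos y hy

lemma kpos (D : Dat F H H1 α w) (x : ℝ) (hx : x ∈ Ioo (0:ℝ) 1) : 0 < kk F x :=
  div_pos (D.Fpos x hx.1.le hx.2) (D.Fpos (1 - x) (by linarith [hx.2]) (by linarith [hx.1]))

lemma kinv (x : ℝ) : kk F (1 - x) = 1 / kk F x := by
  simp [kk]

lemma khalf (D : Dat F H H1 α w) : kk F (1 / 2) = 1 := by
  have := (D.Fpos (1 / 2) (by norm_num) (by norm_num)).ne'
  rw [kk, show (1:ℝ) - 1 / 2 = 1 / 2 by norm_num, div_self this]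

lemma Ftop (D : Dat F H H1 α w) : Tendsto F (𝓝[<] 1) atTop := by
  rw [tendsto_atTop]
  intro M
  obtain ⟨x, hx, h⟩ := D.Fbig M
  filter_upwards [Ioo_mem_nhdsLT hx.2] with y hy
  exact (h y ⟨hy.1.le, hy.2⟩).le

lemma G1 (D : Dat F H H1 α w) : Tendsto (fun x => F (1 - x)) (𝓝[<] 1) (𝓝 1) := by
  have ls : Tendsto (fun x : ℝ => 1 - x) (𝓝[<] 1) (𝓝 0) := by
    have : Continuous (fun x : ℝ => 1 - x) := by fun_prop
    have h := this.tendsto 1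
    simp only [sub_self] at h
    exact h.mono_left nhdsWithin_le_nhds
  have := (D.dF 0 (by simp)).continuousAt.tendsto
  rw [D.F0] at this
  exact this.comp ls

lemma ktop (D : Dat F H H1 α w) : Tendsto (kk F) (𝓝[<] 1) atTop := by
  have := D.Ftop.atTop_mul_pos one_pos (by simpa using D.G1.inv₀ one_ne_zero)
  exact this.congr fun x => by rw [kk, div_eq_mul_inv]

lemma ksurj1 (D : Dat F H H1 α w) (K : ℝ) (hK : 1 ≤ K) : ∃ x ∈ Ioo (0:ℝ) 1, kk F x = K := by
  obtain ⟨x, h1, h2⟩ := ((D.ktop.eventually_ge_atTop K).and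
    (Ioo_mem_nhdsLT (show (0:ℝ) < 1 by norm_num))).exists
  exact isPreconnected_Ioo.intermediate_value (a := 1 / 2) (b := x) (by norm_num) h2 D.kcont
    ⟨by rw [D.khalf]; exact hK, h1⟩

lemma ksurj (D : Dat F H H1 α w) (K : ℝ) (hK : 0 < K) : ∃ x ∈ Ioo (0:ℝ) 1, kk F x = K := by
  rcases le_total 1 K with h | h
  · exact D.ksurj1 K h
  · obtain ⟨x, hx, e⟩ := D.ksurj1 (1 / K) (by rw [le_div_iff₀ hK]; linarith)
    refine ⟨1 - x, ⟨by linarith [hx.2], by linarith [hx.1]⟩, ?_⟩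
    rw [kinv, e]; simp

lemma kimage (D : Dat F H H1 α w) : kk F '' Ioo (1 / 2) 1 = Ioi 1 := by
  have hh : (1 / 2 : ℝ) ∈ Ioo (0:ℝ) 1 := by norm_num
  apply Subset.antisymm
  · rintro _ ⟨x, hx, rfl⟩
    have := D.kmono hh ⟨by linarith [hx.1], hx.2⟩ hx.1
    rwa [D.khalf] at this
  · intro K hK
    have hK : 1 < K := hK
    obtain ⟨x, hx, rfl⟩ := D.ksurj K (by linarith)
    refine ⟨x, ⟨?_, hx.2⟩, rfl⟩
    rw [← D.khalf] at hK
    exact (D.kmono.lt_iff_lt hh hx).1 hK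

/-- `f = log (x/(1-x))`. -/
lemma df (x : ℝ) (hx : x ∈ Ioo (0:ℝ) 1) :
    HasDerivAt (fun x : ℝ => Real.log (x / (1 - x))) (1 / (x * (1 - x))) x := by
  have h0 := hx.1.ne'
  have h1 : 1 - x ≠ 0 := by linarith [hx.2]
  have := ((hasDerivAt_id x).div ((hasDerivAt_id x).const_sub 1) h1).log (div_ne_zero h0 h1)
  convert! this using 1
  simp only [id, Pi.div_apply]
  field_simp
  ring

lemma qcmp (D : Dat F H H1 α w) (x : ℝ) (hx : x ∈ Ioo (1 / 2 : ℝ) 1) :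
    H (1 - x) / (x * F (1 - x) ^ 3) < H x / ((1 - x) * F x ^ 3) := by
  have := D.qmono (a := 1 - x) (b := x) ⟨by linarith [hx.2], by linarith [hx.1]⟩
    ⟨by linarith [hx.1], hx.2⟩ (by linarith [hx.1])
  simpa using this

lemma rho1 (D : Dat F H H1 α w) :
    StrictMonoOn (fun x => 1 / (w * (1 / F x ^ 2 + 1 / F (1 - x) ^ 2))) (Ico (1 / 2) 1) := by
  have hd : ∀ x ∈ Ico (1 / 2 : ℝ) 1, HasDerivAt (fun x => -((F x ^ 2)⁻¹ + (F (1 - x) ^ 2)⁻¹))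
      (2 * α * (H x / ((1 - x) * F x ^ 3) - H (1 - x) / (x * F (1 - x) ^ 3))) x := by
    intro x hx
    have h0 : 0 < x := by linarith [hx.1]
    have h1 : 1 - x ≠ 0 := by linarith [hx.2]
    have p0 := (D.Fpos x h0.le hx.2).ne'
    have p := (D.Fpos (1 - x) (by linarith [hx.2]) (by linarith)).ne'
    have := (((D.dF x (abs_of_Ico h0.le hx.2)).pow 2).inv (by simp [p0])).add
      (((D.dG x h0 hx.2).pow 2).inv (by simp [p])) |>.neg
    convert! this using 1
    simp only [Pi.pow_apply]
    have := h0.ne'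
    field_simp
    ring
  have hm : StrictMonoOn (fun x => -((F x ^ 2)⁻¹ + (F (1 - x) ^ 2)⁻¹)) (Ico (1 / 2) 1) := by
    refine strictMonoOn_of_deriv_pos (convex_Ico _ _)
      (fun x hx => (hd x hx).continuousAt.continuousWithinAt) ?_
    intro x hx
    have hx' := interior_subset hx
    rw [interior_Ico] at hx
    rw [(hd x hx').deriv]
    have := D.qcmp x hx
    have := D.apos
    exact mul_pos (by positivity) (by linarith)
  intro x hx y hy hxy
  have := hm hx hy hxy
  have hp := D.wpos
  have h0 : 0 < y := by linarith [hy.1]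
  have p0 := D.Fpos y h0.le hy.2
  have p := D.Fpos (1 - y) (by linarith [hy.2]) (by linarith)
  apply one_div_lt_one_div_of_lt
  · positivity
  · apply mul_lt_mul_of_pos_left _ hp
    simp only [one_div]
    simp only at this
    linarith

lemma rho3 (D : Dat F H H1 α w) :
    StrictMonoOn (fun x => F x * F (1 - x) / w) (Ico (1 / 2) 1) := by
  have hd : ∀ x ∈ Ico (1 / 2 : ℝ) 1, HasDerivAt (fun x => F x * F (1 - x) / w)
      ((α * H x / (1 - x) * F (1 - x) + F x * (-(α * H (1 - x) / x))) / w) x := by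
    intro x hx
    have h0 : 0 < x := by linarith [hx.1]
    exact ((D.dF x (abs_of_Ico h0.le hx.2)).mul (D.dG x h0 hx.2)).div_const w
  refine strictMonoOn_of_deriv_pos (convex_Ico _ _)
    (fun x hx => (hd x hx).continuousAt.continuousWithinAt) ?_
  intro x hx
  have hx' := interior_subset hx
  rw [interior_Ico] at hx
  rw [(hd x hx').deriv]
  have h0 : 0 < x := by linarith [hx.1]
  have h1 : 0 < 1 - x := by linarith [hx.2]
  have p0 := D.Fpos x h0.le hx.2
  have p := D.Fpos (1 - x) h1.le (by linarith)
  have hh := D.Hge (1 - x) h1.le (by linarith)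
  have q := D.qcmp x hx
  have fm := D.Fmono (a := 1 - x) (b := x) ⟨h1.le, by linarith⟩ ⟨h0.le, hx.2⟩ (by linarith [hx.1])
  apply div_pos _ D.wpos
  set qx := H x / ((1 - x) * F x ^ 3) with hqx
  set qy := H (1 - x) / (x * F (1 - x) ^ 3) with hqy
  have e : α * H x / (1 - x) * F (1 - x) + F x * (-(α * H (1 - x) / x)) =
      α * F x * F (1 - x) * (qx * F x ^ 2 - qy * F (1 - x) ^ 2) := by
    rw [hqx, hqy]; field_simp; ring
  rw [e]
  have qyp : 0 < qy := by rw [hqy]; positivity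
  have := D.apos
  have : qy * F (1 - x) ^ 2 < qx * F x ^ 2 :=
    mul_lt_mul'' q (pow_lt_pow_left₀ fm p.le (by norm_num)) qyp.le (by positivity)
  have : 0 < qx * F x ^ 2 - qy * F (1 - x) ^ 2 := by linarith
  positivity

end Dat

lemma muFn_sqrt (a : ℝ) (h0 : 0 < a) (h1 : a < 1) (x : ℝ) (hx : x ∈ Ioo (0:ℝ) 1) :
    muFn a (√x) = π / (2 * Real.sin (π * a)) / kk (cF a) x := by
  have D := mkDat a h0 h1
  have p0 := D.Fpos x hx.1.le hx.2
  have p := D.Fpos (1 - x) (by linarith [hx.2]) (by linarith [hx.1])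
  have e1 : (√x) ^ 2 = x := Real.sq_sqrt hx.1.le
  have e2 : (√(1 - x)) ^ 2 = 1 - x := Real.sq_sqrt (by linarith [hx.2])
  have e3 : ∀ y, hypF a (1 - a) 1 y = cF a y := fun y => rfl
  rw [muFn, ellK, ellK, e1, e2, e3, e3, kk]
  field_simp

lemma muInv_eq (a : ℝ) (h0 : 0 < a) (h1 : a < 1) (x : ℝ) (hx : x ∈ Ioo (0:ℝ) 1) :
    muInv a (π / (2 * Real.sin (π * a)) / kk (cF a) x) = √x := by
  have D := mkDat a h0 h1
  have hs : 0 < Real.sin (π * a) := Real.sin_pos_of_pos_of_lt_pi (by positivity) (by nlinarith [Real.pi_pos])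
  have hinj : InjOn (muFn a) (Ioo 0 1) := by
    intro r hr s hs' h
    have hr2 : r ^ 2 ∈ Ioo (0:ℝ) 1 := ⟨by have := hr.1; positivity, by nlinarith [hr.1, hr.2]⟩
    have hs2 : s ^ 2 ∈ Ioo (0:ℝ) 1 := ⟨by have := hs'.1; positivity, by nlinarith [hs'.1, hs'.2]⟩
    rw [← Real.sqrt_sq hr.1.le, ← Real.sqrt_sq hs'.1.le, muFn_sqrt a h0 h1 _ hr2, muFn_sqrt a h0 h1 _ hs2] at h
    have k1 := D.kpos _ hr2
    have k2 := D.kpos _ hs2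
    have : kk (cF a) (r ^ 2) = kk (cF a) (s ^ 2) := by
      have hC : π / (2 * Real.sin (π * a)) ≠ 0 := by positivity
      rw [div_eq_div_iff k1.ne' k2.ne'] at h
      exact (mul_left_cancel₀ hC h).symm
    have := D.kmono.injOn hr2 hs2 this
    exact (pow_left_inj₀ hr.1.le hs'.1.le (by norm_num)).1 this
  rw [← muFn_sqrt a h0 h1 x hx]
  refine hinj.leftInvOn_invFunOn ⟨Real.sqrt_pos.2 hx.1, ?_⟩
  rw [Real.sqrt_lt' one_pos]; simpa using hx.2

lemma phiK_eq (a : ℝ) (h0 : 0 < a) (h1 : a < 1) (x : ℝ) (hx : x ∈ Ioo (0:ℝ) 1) :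
    phiK a (kk (cF a) x) (1 / √2) = √x := by
  have D := mkDat a h0 h1
  have e : (1 : ℝ) / √2 = √(1 / 2) := by rw [Real.sqrt_div zero_le_one, Real.sqrt_one]
  rw [phiK, e, muFn_sqrt a h0 h1 _ (by norm_num), D.khalf, div_one]
  exact muInv_eq a h0 h1 x hx

lemma lambda_eq (a : ℝ) (h0 : 0 < a) (h1 : a < 1) (x : ℝ) (hx : x ∈ Ioo (0:ℝ) 1) :
    lambdaA a (kk (cF a) x) = x / (1 - x) := by
  have hx' : 1 - x ∈ Ioo (0:ℝ) 1 := ⟨by linarith [hx.2], by linarith [hx.1]⟩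
  rw [lambdaA, phiK_eq a h0 h1 x hx, ← Dat.kinv, phiK_eq a h0 h1 _ hx', div_pow,
    Real.sq_sqrt hx.1.le, Real.sq_sqrt hx'.1.le]

lemma mono_transfer {k L f : ℝ → ℝ} {s t : Set ℝ} (hk : StrictMonoOn k s) (him : k '' s = t)
    (hL : ∀ x ∈ s, L (k x) = f x) (hf : StrictMonoOn f s) : StrictMonoOn L t := by
  subst him
  rintro _ ⟨x, hx, rfl⟩ _ ⟨y, hy, rfl⟩ hxy
  rw [hL x hx, hL y hy]
  exact hf hx hy ((hk.lt_iff_lt hx hy).1 hxy)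

lemma sin_pa_pos (a : ℝ) (h0 : 0 < a) (h1 : a < 1) : 0 < Real.sin (π * a) :=
  Real.sin_pos_of_pos_of_lt_pi (by positivity) (by nlinarith [Real.pi_pos])

section final
variable (a : ℝ) (h0 : 0 < a) (h1 : a < 1)
include h0 h1

lemma part3 : StrictMonoOn (fun K : ℝ => Real.log (lambdaA a K) / Real.log K) (Set.Ioi 1) := by
  have D := mkDat a h0 h1
  have hsub : Ioo (1 / 2 : ℝ) 1 ⊆ Ioo 0 1 := Ioo_subset_Ioo_left (by norm_num)
  have hsub' : Ico (1 / 2 : ℝ) 1 ⊆ Ioo 0 1 := fun x hx => ⟨by linarith [hx.1], hx.2⟩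
  refine mono_transfer (D.kmono.mono hsub) D.kimage
    (f := fun x => Real.log (x / (1 - x)) / Real.log (kk (cF a) x)) ?_ ?_
  · intro x hx
    simp only [lambda_eq a h0 h1 x (hsub hx)]
  · refine lhop_mono (f := fun x => Real.log (x / (1 - x))) (g := fun x => Real.log (kk (cF a) x))
      (by norm_num) (by simp only [D.khalf, Real.log_one])
      (fun y hy => Dat.df y (hsub' hy)) (fun y hy => (D.dk y (hsub' hy)).log (D.kpos y (hsub' hy)).ne')
      (fun y hy => div_pos (D.dkpos y (hsub' hy)) (D.kpos y (hsub' hy))) ?_ D.rho3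
    intro x hx
    have hx := hsub' hx
    have := (sin_pa_pos a h0 h1).ne'
    have := (D.Fpos x hx.1.le hx.2).ne'
    have := (D.Fpos (1 - x) (by linarith [hx.2]) (by linarith [hx.1])).ne'
    have := hx.1.ne'
    have : 1 - x ≠ 0 := by linarith [hx.2]
    rw [kk]
    field_simp

lemma part1_s16 : StrictMonoOn (fun K : ℝ => Real.log (lambdaA a K) / (K - 1 / K)) (Set.Ioi 1) ∧
      (fun K : ℝ => Real.log (lambdaA a K) / (K - 1 / K)) '' (Set.Ioi 1) =
        Set.Ioo (2 * (ellK a (1 / Real.sqrt 2)) ^ 2 / (Real.pi * Real.sin (Real.pi * a)))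
          (Real.pi / Real.sin (Real.pi * a)) := by
  have D := mkDat a h0 h1
  have hs : 0 < Real.sin (π * a) := Real.sin_pos_of_pos_of_lt_pi (by positivity) (by nlinarith [Real.pi_pos])
  have hsub : Ioo (1 / 2 : ℝ) 1 ⊆ Ioo 0 1 := Ioo_subset_Ioo_left (by norm_num)
  have hsub' : Ico (1 / 2 : ℝ) 1 ⊆ Ioo 0 1 := fun x hx => ⟨by linarith [hx.1], hx.2⟩
  set g : ℝ → ℝ := fun x => kk (cF a) x - 1 / kk (cF a) x with hgdef
  set k' : ℝ → ℝ := fun x => Real.sin (π * a) / π / (x * (1 - x) * cF a (1 - x) ^ 2) with hk'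
  set ρ : ℝ → ℝ := fun x => 1 / (Real.sin (π * a) / π * (1 / cF a x ^ 2 + 1 / cF a (1 - x) ^ 2)) with hρ
  have hL : ∀ x ∈ Ioo (1 / 2 : ℝ) 1, (fun K : ℝ => Real.log (lambdaA a K) / (K - 1 / K)) (kk (cF a) x)
      = Real.log (x / (1 - x)) / g x := by
    intro x hx
    simp only [lambda_eq a h0 h1 x (hsub hx), hgdef]
  have hg : ∀ x ∈ Ico (1 / 2 : ℝ) 1, HasDerivAt g (k' x + k' x / kk (cF a) x ^ 2) x := by
    intro x hx
    have hd := D.dk x (hsub' hx)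
    have := hd.sub (hd.inv (D.kpos x (hsub' hx)).ne')
    convert! this using 1
    · simp only [hgdef, one_div]; rfl
    · simp only [hk']; ring
  have hg' : ∀ x ∈ Ico (1 / 2 : ℝ) 1, 0 < k' x + k' x / kk (cF a) x ^ 2 := by
    intro x hx
    have h1 := D.dkpos x (hsub' hx)
    have h2 := D.kpos x (hsub' hx)
    simp only [hk']
    positivity
  have hr : ∀ x ∈ Ico (1 / 2 : ℝ) 1, 1 / (x * (1 - x)) = ρ x * (k' x + k' x / kk (cF a) x ^ 2) := by
    intro x hx
    have hx := hsub' hx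
    have := (D.Fpos x hx.1.le hx.2)
    have := (D.Fpos (1 - x) (by linarith [hx.2]) (by linarith [hx.1]))
    have := hx.1
    have : 0 < 1 - x := by linarith [hx.2]
    simp only [hk', hρ, kk]
    have : cF a x ^ 2 + cF a (1 - x) ^ 2 ≠ 0 := by positivity
    have : cF a (1 - x) ^ 2 + cF a x ^ 2 ≠ 0 := by positivity
    field_simp
    try ring
  have hfb : (fun x : ℝ => Real.log (x / (1 - x))) (1 / 2) = 0 := by norm_num
  have hgb : g (1 / 2) = 0 := by simp only [hgdef, D.khalf]; norm_num
  refine ⟨mono_transfer (D.kmono.mono hsub) D.kimage hL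
    (lhop_mono (f := fun x => Real.log (x / (1 - x))) (g := g) hfb hgb
      (fun y hy => Dat.df y (hsub' hy)) hg hg' hr D.rho1), ?_⟩
  have hρl : Tendsto ρ (𝓝[<] 1) (𝓝 (π / Real.sin (π * a))) := by
    have t1 : Tendsto (fun x => 1 / cF a x ^ 2) (𝓝[<] 1) (𝓝 0) := by
      simp only [one_div]
      exact ((tendsto_pow_atTop two_ne_zero).comp D.Ftop).inv_tendsto_atTop
    have t2 : Tendsto (fun x => 1 / cF a (1 - x) ^ 2) (𝓝[<] 1) (𝓝 1) := by
      have := (D.G1.pow 2).inv₀ (by norm_num)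
      simpa [one_div] using this
    have t3 := ((t1.add t2).const_mul (Real.sin (π * a) / π)).inv₀ (by simp [hs.ne', Real.pi_ne_zero])
    convert! t3 using 1
    · funext x; simp only [hρ, one_div]
    · congr 1; simp
  have hgl : Tendsto g (𝓝[<] 1) atTop := by
    have h := D.ktop.atTop_add (D.ktop.inv_tendsto_atTop.neg)
    refine h.congr fun x => ?_
    simp only [hgdef, one_div, sub_eq_add_neg]; rfl
  have hρc : ContinuousAt ρ (1 / 2) := by
    have c1 := (D.dF (1 / 2) (by norm_num [abs_of_pos])).continuousAt
    have c2 := (D.dG (1 / 2) (by norm_num) (by norm_num)).continuousAt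
    have p1 := D.Fpos (1 / 2) (by norm_num) (by norm_num)
    have p2 := D.Fpos (1 - 1 / 2) (by norm_num) (by norm_num)
    have pw := D.wpos
    refine continuousAt_const.div (continuousAt_const.mul
      ((continuousAt_const.div (c1.pow 2) (pow_pos p1 2).ne').add
        (continuousAt_const.div (c2.pow 2) (pow_pos p2 2).ne'))) ?_
    positivity
  have him := lhop_image (f := fun x => Real.log (x / (1 - x))) (g := g) (by norm_num) hfb hgb
      (fun y hy => Dat.df y (hsub' hy)) hg hg' hr D.rho1 hρc hρl hgl
  have hρh : ρ (1 / 2) = 2 * (ellK a (1 / Real.sqrt 2)) ^ 2 / (Real.pi * Real.sin (Real.pi * a)) := by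
    have e3 : ∀ y, hypF a (1 - a) 1 y = cF a y := fun y => rfl
    have p1 := D.Fpos (1 / 2) (by norm_num) (by norm_num)
    have e : ((1:ℝ) / √2) ^ 2 = 1 / 2 := by rw [div_pow, Real.sq_sqrt (by norm_num)]; norm_num
    simp only [hρ]
    rw [ellK, e, e3, show (1:ℝ) - 1 / 2 = 1 / 2 by norm_num]
    field_simp
    try norm_num
  have him' : (fun x => Real.log (x / (1 - x)) / g x) '' Ioo (1 / 2) 1 = Ioo (ρ (1 / 2)) (π / Real.sin (π * a)) := him
  rw [← hρh, ← him', ← D.kimage, image_image]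
  exact image_congr hL

lemma part2_s16 : ConvexOn ℝ (Set.Ioi 0) (fun K : ℝ => Real.log (lambdaA a K + 1)) ∧
      ConcaveOn ℝ (Set.Ioi 0) (fun K : ℝ => Real.log (lambdaA a K)) := by
  have D := mkDat a h0 h1
  have pw := D.wpos
  constructor
  · refine conv_param D.dk D.dkpos D.ksurj (f := fun x => -Real.log (1 - x)) (f' := fun x => 1 / (1 - x))
      (ρ := fun x => x * cF a (1 - x) ^ 2 / (Real.sin (π * a) / π)) ?_ ?_ ?_ ?_
    · intro x hx
      have : 1 - x ≠ 0 := by linarith [hx.2]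
      simp only [lambda_eq a h0 h1 x hx]
      rw [← Real.log_inv]
      congr 1
      field_simp
      ring
    · intro x hx
      have : 1 - x ≠ 0 := by linarith [hx.2]
      have := (((hasDerivAt_id x).const_sub 1).log this).neg
      convert! this using 1
      simp only [id]; ring
    · intro x hx
      have := (D.Fpos (1 - x) (by linarith [hx.2]) (by linarith [hx.1]))
      have := hx.1
      have : 0 < 1 - x := by linarith [hx.2]
      have hs := (sin_pa_pos a h0 h1).ne'
      field_simp
    · intro x hx y hy hxy
      apply div_lt_div_of_pos_right _ pw
      have := D.sqAnti (a := 1 - y) (b := 1 - x) ⟨by linarith [hy.2], by linarith [hy.1]⟩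
        ⟨by linarith [hx.2], by linarith [hx.1]⟩ (by linarith)
      simpa using this
  · rw [← neg_convexOn_iff]
    refine conv_param D.dk D.dkpos D.ksurj (f := fun x => -Real.log (x / (1 - x))) (f' := fun x => -(1 / (x * (1 - x))))
      (ρ := fun x => -(cF a (1 - x) ^ 2 / (Real.sin (π * a) / π))) ?_ ?_ ?_ ?_
    · intro x hx
      simp only [Pi.neg_apply, lambda_eq a h0 h1 x hx]
    · intro x hx
      exact (Dat.df x hx).neg
    · intro x hx
      have := (D.Fpos (1 - x) (by linarith [hx.2]) (by linarith [hx.1]))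
      have := hx.1
      have : 0 < 1 - x := by linarith [hx.2]
      have hs := (sin_pa_pos a h0 h1).ne'
      field_simp
    · intro x hx y hy hxy
      apply neg_lt_neg
      apply div_lt_div_of_pos_right _ pw
      have := D.Fmono (a := 1 - y) (b := 1 - x) ⟨by linarith [hy.2], by linarith [hy.1]⟩
        ⟨by linarith [hx.2], by linarith [hx.1]⟩ (by linarith)
      exact pow_lt_pow_left₀ this (D.Fpos (1 - y) (by linarith [hy.2]) (by linarith [hy.1])).le (by norm_num)

lemma lambda_pos (K : ℝ) (hK : 0 < K) : 0 < lambdaA a K := by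
  have D := mkDat a h0 h1
  obtain ⟨x, hx, rfl⟩ := D.ksurj K hK
  rw [lambda_eq a h0 h1 x hx]
  exact div_pos hx.1 (by linarith [hx.2])

lemma part4 (K c : ℝ) (hK : 1 < K) (hc : c ∈ Set.Ioo (0:ℝ) 1) :
        lambdaA a (K ^ c) < (lambdaA a K) ^ c := by
  have hK0 : 0 < K := by linarith
  have hKc : 1 < K ^ c := Real.one_lt_rpow hK hc.1
  have hlt : K ^ c < K := by
    have := Real.rpow_lt_rpow_of_exponent_lt hK hc.2
    rwa [Real.rpow_one] at this
  have h := part3 a h0 h1 hKc hK hlt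
  have hl : 0 < Real.log K := Real.log_pos hK
  simp only at h
  rw [Real.log_rpow hK0, div_lt_div_iff₀ (mul_pos hc.1 hl) hl] at h
  have p1 := lambda_pos a h0 h1 (K ^ c) (by linarith)
  have p2 := lambda_pos a h0 h1 K hK0
  rw [← Real.log_lt_log_iff p1 (by positivity), Real.log_rpow p2]
  have : Real.log (lambdaA a (K ^ c)) * Real.log K < (c * Real.log (lambdaA a K)) * Real.log K := by
    linarith
  exact lt_of_mul_lt_mul_right this hl.le

end final

theorem stmt16 (a : ℝ) (ha : a ∈ Set.Ioc (0:ℝ) (1/2)) :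
    (StrictMonoOn (fun K : ℝ => Real.log (lambdaA a K) / (K - 1 / K)) (Set.Ioi 1) ∧
      (fun K : ℝ => Real.log (lambdaA a K) / (K - 1 / K)) '' (Set.Ioi 1) =
        Set.Ioo (2 * (ellK a (1 / Real.sqrt 2)) ^ 2 / (Real.pi * Real.sin (Real.pi * a)))
          (Real.pi / Real.sin (Real.pi * a))) ∧
    (ConvexOn ℝ (Set.Ioi 0) (fun K : ℝ => Real.log (lambdaA a K + 1)) ∧
      ConcaveOn ℝ (Set.Ioi 0) (fun K : ℝ => Real.log (lambdaA a K))) ∧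
    (StrictMonoOn (fun K : ℝ => Real.log (lambdaA a K) / Real.log K) (Set.Ioi 1) ∧
      ∀ K c : ℝ, 1 < K → c ∈ Set.Ioo (0:ℝ) 1 →
        lambdaA a (K ^ c) < (lambdaA a K) ^ c) := by
  have h1 : a < 1 := by linarith [ha.2]
  exact ⟨part1_s16 a ha.1 h1, part2_s16 a ha.1 h1, part3 a ha.1 h1, part4 a ha.1 h1⟩
end
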